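/- arXiv:1411.0650 — 12 statements merged into one kernel-verified Lean document; each statement's English description precedes it below -/
import Mathlib

section
/- In the random k-SAT model with n variables, m clauses and clause length k (with n ≥ 1, k ≥ 1, m ≥ 0), for every integer j with 0 ≤ j ≤ n, the expected number of ordered pairs (x¹, x²) of satisfying assignments that agree on exactly j variables (i.e. |{v : x¹(v) = x²(v)}| = j) equals 2^n · C(n, j) · (1 − 2·2^{−k} + (j/(2n))^k)^m, where C(n,j) is the binomial coefficient. -/
/-- The number of ordered pairs of satisfying assignments of the instance `ω` that agree
on exactly `j` variables. -/
def satPairCount (n m k : ℕ) (ω : Fin m → Fin k → Fin n × Bool) (j : ℕ) : ℕ :=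
  (Finset.univ.filter fun p : (Fin n → Bool) × (Fin n → Bool) =>
    (∀ a : Fin m, ∃ i : Fin k, p.1 (ω a i).1 = (ω a i).2) ∧
    (∀ a : Fin m, ∃ i : Fin k, p.2 (ω a i).1 = (ω a i).2) ∧
    (Finset.univ.filter fun v : Fin n => p.1 v = p.2 v).card = j).card

/-- The number of functions all of whose values satisfy `P`. -/
theorem card_filter_forall_apply {ι α : Type*} [Fintype ι] [DecidableEq ι] [Fintype α]
    (P : α → Prop) [DecidablePred P] [DecidablePred fun f : ι → α => ∀ i, P (f i)] :
    (Finset.univ.filter fun f : ι → α => ∀ i, P (f i)).card =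
      (Finset.univ.filter P).card ^ Fintype.card ι := by
  have h : (Finset.univ.filter fun f : ι → α => ∀ i, P (f i)) =
      Fintype.piFinset fun _ => Finset.univ.filter P := by
    ext f
    simp [Fintype.mem_piFinset]
  rw [h, Fintype.card_piFinset, Finset.prod_const, Finset.card_univ]

/-- The literals violated by both `x` and `y` correspond to the variables where they agree. -/
theorem card_filter_literal_violated {V : Type*} [Fintype V] (x y : V → Bool) :
    (Finset.univ.filter fun l : V × Bool => ¬ x l.1 = l.2 ∧ ¬ y l.1 = l.2).card =
      (Finset.univ.filter fun v : V => x v = y v).card := by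
  refine Finset.card_nbij' (fun l => l.1) (fun v => (v, !x v)) ?_ ?_ ?_ ?_
  · rintro ⟨v, b⟩ h
    simp only [Finset.coe_filter, Finset.mem_univ, true_and, Set.mem_ofPred_eq] at h ⊢
    cases hx : x v <;> cases hy : y v <;> cases b <;> simp_all
  · intro v h
    simp only [Finset.coe_filter, Finset.mem_univ, true_and, Set.mem_ofPred_eq] at h ⊢
    grind
  · rintro ⟨v, b⟩ h
    simp only [Finset.coe_filter, Finset.mem_univ, true_and, Set.mem_ofPred_eq] at h
    cases hx : x v <;> cases b <;> simp_all
  · intro v h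
    rfl

/-- The number of `k`-clauses violated by both `x` and `y`. -/
theorem card_filter_clause_violated {V : Type*} [Fintype V] (k : ℕ) (x y : V → Bool) :
    (Finset.univ.filter fun c : Fin k → V × Bool =>
      (∀ i, ¬ x (c i).1 = (c i).2) ∧ ∀ i, ¬ y (c i).1 = (c i).2).card =
      (Finset.univ.filter fun v : V => x v = y v).card ^ k := by
  classical
  simp only [← forall_and]
  rw [card_filter_forall_apply (fun l : V × Bool => ¬ x l.1 = l.2 ∧ ¬ y l.1 = l.2),
    card_filter_literal_violated, Fintype.card_fin]

/-- The number of `k`-clauses satisfied by both `x` and `y`, by inclusion-exclusion. -/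
theorem card_filter_clause_satisfied {V : Type*} [Fintype V] (k : ℕ) (x y : V → Bool) :
    ((Finset.univ.filter fun c : Fin k → V × Bool =>
      (∃ i, x (c i).1 = (c i).2) ∧ ∃ i, y (c i).1 = (c i).2).card : ℝ) =
      (2 * (Fintype.card V : ℝ)) ^ k - 2 * (Fintype.card V : ℝ) ^ k +
        ((Finset.univ.filter fun v : V => x v = y v).card : ℝ) ^ k := by
  classical
  have violated (z : V → Bool) : (Finset.univ.filter fun c : Fin k → V × Bool =>
      ∀ i, ¬ z (c i).1 = (c i).2).card = Fintype.card V ^ k := by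
    simpa using card_filter_clause_violated k z z
  have hxy := card_filter_clause_violated k x y
  have hunion := Finset.card_union_add_card_inter
    (Finset.univ.filter fun c : Fin k → V × Bool => ∀ i, ¬ x (c i).1 = (c i).2)
    (Finset.univ.filter fun c : Fin k → V × Bool => ∀ i, ¬ y (c i).1 = (c i).2)
  rw [← Finset.filter_or, ← Finset.filter_and, violated, violated, hxy] at hunion
  have htotal := Finset.card_filter_add_card_filter_not (s := Finset.univ)
    (fun c : Fin k → V × Bool =>
      (∀ i, ¬ x (c i).1 = (c i).2) ∨ ∀ i, ¬ y (c i).1 = (c i).2)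
  simp only [not_or, not_forall, not_not] at htotal
  have hcard : (Finset.univ : Finset (Fin k → V × Bool)).card = (2 * Fintype.card V) ^ k := by
    simp [mul_comm]
  rw [hcard] at htotal
  have hunion' := congrArg (Nat.cast (R := ℝ)) hunion
  have htotal' := congrArg (Nat.cast (R := ℝ)) htotal
  push_cast at hunion' htotal'
  linarith

/-- The number of assignments agreeing with `x` on exactly `j` variables. -/
theorem card_filter_agree_eq {V : Type*} [Fintype V] [DecidableEq V] (x : V → Bool) (j : ℕ) :
    (Finset.univ.filter fun y : V → Bool =>
      (Finset.univ.filter fun v : V => x v = y v).card = j).card =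
      (Fintype.card V).choose j := by
  rw [← Finset.card_univ, ← Finset.card_powersetCard]
  refine Finset.card_nbij' (fun y => Finset.univ.filter fun v => x v = y v)
    (fun s v => if v ∈ s then x v else !x v) ?_ ?_ ?_ ?_
  · intro y hy
    simpa [Finset.mem_powersetCard] using hy
  · intro s hs
    have h : (Finset.univ.filter fun v => x v = if v ∈ s then x v else !x v) = s := by
      ext v
      by_cases hv : v ∈ s <;> simp [hv]
    simpa [Finset.mem_powersetCard, h] using hs
  · intro y _
    funext v
    by_cases hv : x v = y v
    · simp [hv]
    · simpa [hv] using Bool.not_eq.mpr hv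
  · intro s _
    ext v
    by_cases hv : v ∈ s <;> simp [hv]

/-- The number of ordered pairs of assignments agreeing on exactly `j` variables. -/
theorem card_filter_pair_agree_eq {V : Type*} [Fintype V] [DecidableEq V] (j : ℕ) :
    (Finset.univ.filter fun p : (V → Bool) × (V → Bool) =>
      (Finset.univ.filter fun v : V => p.1 v = p.2 v).card = j).card =
      2 ^ Fintype.card V * (Fintype.card V).choose j := by
  rw [Finset.card_filter, Fintype.sum_prod_type]
  simp only [← Finset.card_filter, card_filter_agree_eq]
  simp

/-- The total number of satisfying pairs over all instances, by exchanging the sums. -/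
theorem sum_satPairCount (n m k j : ℕ) :
    (∑ ω : Fin m → Fin k → Fin n × Bool, (satPairCount n m k ω j : ℝ)) =
      2 ^ n * (n.choose j : ℝ) *
        ((2 * (n : ℝ)) ^ k - 2 * (n : ℝ) ^ k + (j : ℝ) ^ k) ^ m := by
  have hpair (p : (Fin n → Bool) × (Fin n → Bool)) :
      (∑ ω : Fin m → Fin k → Fin n × Bool, if
        (∀ a : Fin m, ∃ i : Fin k, p.1 (ω a i).1 = (ω a i).2) ∧
        (∀ a : Fin m, ∃ i : Fin k, p.2 (ω a i).1 = (ω a i).2) ∧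
        (Finset.univ.filter fun v : Fin n => p.1 v = p.2 v).card = j then (1 : ℝ) else 0) =
      if (Finset.univ.filter fun v : Fin n => p.1 v = p.2 v).card = j then
        ((2 * (n : ℝ)) ^ k - 2 * (n : ℝ) ^ k + (j : ℝ) ^ k) ^ m else 0 := by
    split_ifs with h
    · simp only [h, and_true, ← forall_and, Finset.sum_boole]
      rw [card_filter_forall_apply (fun c : Fin k → Fin n × Bool =>
        (∃ i, p.1 (c i).1 = (c i).2) ∧ ∃ i, p.2 (c i).1 = (c i).2)]
      push_cast
      rw [card_filter_clause_satisfied, h]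
      simp
    · simp [h]
  simp only [satPairCount, Finset.card_filter, Nat.cast_sum, Nat.cast_ite, Nat.cast_one,
    Nat.cast_zero]
  rw [Finset.sum_comm]
  simp only [← Finset.card_filter, hpair]
  rw [← Finset.sum_filter, Finset.sum_const, card_filter_pair_agree_eq]
  simp

/-- In the random `k`-SAT model with `n ≥ 1` variables, `m` clauses and clause length
`k ≥ 1`, for every `0 ≤ j ≤ n`, the expected number (over the uniformly random instance)
of ordered pairs of satisfying assignments agreeing on exactly `j` variables equals
`2 ^ n * (n choose j) * (1 - 2 * 2 ^ (-k) + (j / (2 n)) ^ k) ^ m`. -/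
theorem expected_number_of_sat_pairs (n m k : ℕ) (hn : 1 ≤ n) (hk : 1 ≤ k)
    (j : ℕ) (hj : j ≤ n) :
    (∑ ω : Fin m → Fin k → Fin n × Bool, (satPairCount n m k ω j : ℝ)) /
      (Fintype.card (Fin m → Fin k → Fin n × Bool) : ℝ) =
    2 ^ n * (n.choose j : ℝ) *
      (1 - 2 * (2 : ℝ) ^ (-(k : ℤ)) + ((j : ℝ) / (2 * (n : ℝ))) ^ k) ^ m := by
  have hn0 : (n : ℝ) ≠ 0 := by positivity
  have hratio : 1 - 2 * (2 : ℝ) ^ (-(k : ℤ)) + ((j : ℝ) / (2 * (n : ℝ))) ^ k =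
      ((2 * (n : ℝ)) ^ k - 2 * (n : ℝ) ^ k + (j : ℝ) ^ k) / (2 * (n : ℝ)) ^ k := by
    rw [zpow_neg, zpow_natCast, div_pow, mul_pow]
    field_simp
  have hcard : (Fintype.card (Fin m → Fin k → Fin n × Bool) : ℝ) =
      ((2 * (n : ℝ)) ^ k) ^ m := by
    simp [mul_comm]
  rw [sum_satPairCount, hratio, hcard, div_pow, mul_div_assoc]
end

section
/- In the random k-SAT model with n variables, m clauses and clause length k (with n ≥ 1, k ≥ 1, m ≥ 0), for every integer j with 0 ≤ j ≤ n, the expected number of ordered pairs (x¹, x²) of NAE-satisfying assignments that agree on exactly j variables equals 2^n · C(n, j) · (1 − 2^{2−k} + 2^{1−k}·((j/n)^k + ((n−j)/n)^k))^m, where C(n,j) is the binomial coefficient. -/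
/-- The number of ordered pairs of NAE-satisfying assignments of the instance `ω` that
agree on exactly `j` variables.  An assignment NAE-satisfies a clause if among its `k`
literals at least one is satisfied and at least one is not satisfied. -/
def naeSatPairCount (n m k : ℕ) (ω : Fin m → Fin k → Fin n × Bool) (j : ℕ) : ℕ :=
  (Finset.univ.filter fun p : (Fin n → Bool) × (Fin n → Bool) =>
    (∀ a : Fin m, (∃ i : Fin k, p.1 (ω a i).1 = (ω a i).2) ∧
      (∃ i : Fin k, p.1 (ω a i).1 ≠ (ω a i).2)) ∧
    (∀ a : Fin m, (∃ i : Fin k, p.2 (ω a i).1 = (ω a i).2) ∧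
      (∃ i : Fin k, p.2 (ω a i).1 ≠ (ω a i).2)) ∧
    (Finset.univ.filter fun v : Fin n => p.1 v = p.2 v).card = j).card

/-- The assignment `x` NAE-satisfies the clause `c`. -/
def IsNaeSat {n k : ℕ} (x : Fin n → Bool) (c : Fin k → Fin n × Bool) : Prop :=
  (∃ i : Fin k, x (c i).1 = (c i).2) ∧ (∃ i : Fin k, x (c i).1 ≠ (c i).2)

/-- The `0`-`1` indicator that the literal `l` has truth value `b` under `x`. -/
def literalIndicator {n : ℕ} (b : Bool) (x : Fin n → Bool) (l : Fin n × Bool) : ℝ :=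
  if (x l.1 == l.2) = b then 1 else 0

open Classical in
lemma indicator_isNaeSat {n k : ℕ} (hk : 1 ≤ k) (x : Fin n → Bool) (c : Fin k → Fin n × Bool) :
    (if IsNaeSat x c then (1 : ℝ) else 0) =
      1 - ∏ i, literalIndicator true x (c i) - ∏ i, literalIndicator false x (c i) := by
  have : Nonempty (Fin k) := ⟨⟨0, hk⟩⟩
  unfold IsNaeSat literalIndicator
  simp only [Finset.prod_ite_zero, Finset.prod_const_one, Finset.mem_univ, true_implies,
    beq_iff_eq, beq_eq_false_iff_ne]
  by_cases h : ∀ i, x (c i).1 = (c i).2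
  · simp [h]
  · by_cases h' : ∀ i, x (c i).1 ≠ (c i).2
    · simp [h']
    · have h₁ := h
      have h₂ := h'
      push Not at h₁ h₂
      simp only [if_neg h, if_neg h', if_pos (And.intro h₂ h₁)]
      norm_num

lemma sum_literalIndicator {n : ℕ} (b : Bool) (x : Fin n → Bool) :
    ∑ l, literalIndicator b x l = n := by
  have h (v : Fin n) : ∑ s, literalIndicator b x (v, s) = 1 := by
    cases b <;> cases hx : x v <;> simp [literalIndicator, hx]
  simp only [Fintype.sum_prod_type, h]
  simp

lemma sum_literalIndicator_mul {n : ℕ} (b b' : Bool) (x y : Fin n → Bool) :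
    ∑ l, literalIndicator b x l * literalIndicator b' y l =
      if b = b' then ((Finset.univ.filter fun v => x v = y v).card : ℝ)
      else n - ((Finset.univ.filter fun v => x v = y v).card : ℝ) := by
  have h (v : Fin n) : ∑ s, literalIndicator b x (v, s) * literalIndicator b' y (v, s) =
      if b = b' then (if x v = y v then (1 : ℝ) else 0)
      else 1 - (if x v = y v then (1 : ℝ) else 0) := by
    cases b <;> cases b' <;> cases hx : x v <;> cases hy : y v <;>
      simp [literalIndicator, hx, hy]
  simp only [Fintype.sum_prod_type, h]
  split_ifs <;> simp

open Classical in
/-- The number of clauses of length `k` NAE-satisfied by both `x` and `y`. -/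
lemma card_clause_isNaeSat_both {n k : ℕ} (hk : 1 ≤ k) (x y : Fin n → Bool) (j : ℕ)
    (hj : (Finset.univ.filter fun v => x v = y v).card = j) :
    ∑ c : Fin k → Fin n × Bool, (if IsNaeSat x c ∧ IsNaeSat y c then (1 : ℝ) else 0) =
      (2 * n : ℝ) ^ k - 4 * (n : ℝ) ^ k + 2 * ((j : ℝ) ^ k + ((n : ℝ) - j) ^ k) := by
  have hmul (b b' : Bool) : ∑ c : Fin k → Fin n × Bool,
      (∏ i, literalIndicator b x (c i)) * ∏ i, literalIndicator b' y (c i) =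
        (if b = b' then (j : ℝ) else n - j) ^ k := by
    simp only [← Finset.prod_mul_distrib]
    rw [← hj, ← sum_literalIndicator_mul, Fintype.sum_pow]
  have hone (b : Bool) (z : Fin n → Bool) : ∑ c : Fin k → Fin n × Bool,
      ∏ i, literalIndicator b z (c i) = (n : ℝ) ^ k := by
    rw [← sum_literalIndicator b z, Fintype.sum_pow]
  have hsplit (c : Fin k → Fin n × Bool) :
      (if IsNaeSat x c ∧ IsNaeSat y c then (1 : ℝ) else 0) =
        1 - ∏ i, literalIndicator true x (c i) - ∏ i, literalIndicator false x (c i)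
        - ∏ i, literalIndicator true y (c i) - ∏ i, literalIndicator false y (c i)
        + (∏ i, literalIndicator true x (c i)) * ∏ i, literalIndicator true y (c i)
        + (∏ i, literalIndicator true x (c i)) * ∏ i, literalIndicator false y (c i)
        + (∏ i, literalIndicator false x (c i)) * ∏ i, literalIndicator true y (c i)
        + (∏ i, literalIndicator false x (c i)) * ∏ i, literalIndicator false y (c i) := by
    rw [ite_and, ← mul_boole, indicator_isNaeSat hk, ← mul_boole, indicator_isNaeSat hk]
    ring
  simp only [hsplit, Finset.sum_add_distrib, Finset.sum_sub_distrib, hmul, hone]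
  simp
  ring

/-- The number of ordered pairs of assignments agreeing on exactly `j` variables. -/
lemma card_pairs_agreeing (n j : ℕ) :
    (Finset.univ.filter fun p : (Fin n → Bool) × (Fin n → Bool) =>
      (Finset.univ.filter fun v => p.1 v = p.2 v).card = j).card = 2 ^ n * n.choose j := by
  have h : 2 ^ n * n.choose j = ((Finset.univ : Finset (Fin n → Bool)) ×ˢ
      Finset.powersetCard j (Finset.univ : Finset (Fin n))).card := by
    simp
  rw [h]
  refine Finset.card_nbij' (fun p => (p.1, Finset.univ.filter fun v => p.1 v = p.2 v))
    (fun q => (q.1, fun v => if v ∈ q.2 then q.1 v else !q.1 v)) ?_ ?_ ?_ ?_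
  · intro p hp
    simpa [Finset.mem_powersetCard] using hp
  · intro q hq
    simpa [Finset.mem_powersetCard] using hq
  · intro p _
    refine Prod.ext rfl (funext fun v => ?_)
    cases h₁ : p.1 v <;> cases h₂ : p.2 v <;> simp [h₁, h₂]
  · intro q _
    refine Prod.ext rfl (Finset.ext fun v => ?_)
    by_cases hv : v ∈ q.2 <;> simp [hv]

open Classical in
lemma sum_naeSatPairCount (n m k : ℕ) (hk : 1 ≤ k) (j : ℕ) :
    ∑ ω : Fin m → Fin k → Fin n × Bool, (naeSatPairCount n m k ω j : ℝ) =
      2 ^ n * (n.choose j : ℝ) *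
        ((2 * n : ℝ) ^ k - 4 * (n : ℝ) ^ k + 2 * ((j : ℝ) ^ k + ((n : ℝ) - j) ^ k)) ^ m := by
  have hcount (ω : Fin m → Fin k → Fin n × Bool) : (naeSatPairCount n m k ω j : ℝ) =
      ∑ p ∈ Finset.univ.filter (fun p : (Fin n → Bool) × (Fin n → Bool) =>
        (Finset.univ.filter fun v => p.1 v = p.2 v).card = j),
        ∏ a, (if IsNaeSat p.1 (ω a) ∧ IsNaeSat p.2 (ω a) then (1 : ℝ) else 0) := by
    simp only [Finset.prod_ite_zero, Finset.prod_const_one]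
    rw [Finset.sum_boole, Finset.filter_filter, naeSatPairCount]
    refine congrArg (fun s : Finset _ => (s.card : ℝ)) (Finset.ext fun p => ?_)
    unfold IsNaeSat
    simp only [Finset.mem_filter, Finset.mem_univ, true_and, true_implies, forall_and]
    tauto
  simp only [hcount]
  rw [Finset.sum_comm]
  have hpair (p : (Fin n → Bool) × (Fin n → Bool)) (hp : p ∈ Finset.univ.filter
      (fun p : (Fin n → Bool) × (Fin n → Bool) =>
        (Finset.univ.filter fun v => p.1 v = p.2 v).card = j)) :
      ∑ ω : Fin m → Fin k → Fin n × Bool,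
        ∏ a, (if IsNaeSat p.1 (ω a) ∧ IsNaeSat p.2 (ω a) then (1 : ℝ) else 0) =
      ((2 * n : ℝ) ^ k - 4 * (n : ℝ) ^ k + 2 * ((j : ℝ) ^ k + ((n : ℝ) - j) ^ k)) ^ m := by
    rw [← card_clause_isNaeSat_both hk p.1 p.2 j (Finset.mem_filter.1 hp).2, Fintype.sum_pow]
  rw [Finset.sum_congr rfl hpair, Finset.sum_const, card_pairs_agreeing, nsmul_eq_mul]
  push_cast
  rfl

/-- In the random `k`-SAT model with `n ≥ 1` variables, `m` clauses and clause length
`k ≥ 1`, for every `0 ≤ j ≤ n`, the expected number (over the uniformly random instance)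
of ordered pairs of NAE-satisfying assignments agreeing on exactly `j` variables equals
`2 ^ n * (n choose j) * (1 - 2 ^ (2-k) + 2 ^ (1-k) ((j/n) ^ k + ((n-j)/n) ^ k)) ^ m`. -/
theorem expected_number_of_naesat_pairs (n m k : ℕ) (hn : 1 ≤ n) (hk : 1 ≤ k)
    (j : ℕ) (hj : j ≤ n) :
    (∑ ω : Fin m → Fin k → Fin n × Bool, (naeSatPairCount n m k ω j : ℝ)) /
      (Fintype.card (Fin m → Fin k → Fin n × Bool) : ℝ) =
    2 ^ n * (n.choose j : ℝ) *
      (1 - (2 : ℝ) ^ ((2 : ℤ) - (k : ℤ)) +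
        (2 : ℝ) ^ ((1 : ℤ) - (k : ℤ)) *
          (((j : ℝ) / (n : ℝ)) ^ k + (((n : ℝ) - (j : ℝ)) / (n : ℝ)) ^ k)) ^ m := by
  rw [sum_naeSatPairCount n m k hk j]
  have hn' : (n : ℝ) ≠ 0 := by positivity
  have hcard : (Fintype.card (Fin m → Fin k → Fin n × Bool) : ℝ) = ((2 * n : ℝ) ^ k) ^ m := by
    simp [mul_comm]
  rw [hcard, mul_div_assoc, ← div_pow, zpow_sub₀ two_ne_zero, zpow_sub₀ two_ne_zero]
  congr 2
  simp only [zpow_natCast, mul_pow, div_pow]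
  field_simp
  norm_num
end

section
/- For every integer k ≥ 1, the unique positive root α₁ = log 2 / (−log(1 − 2^{−k})) of the first-moment exponent φ₁(α) = log 2 + α·log(1 − 2^{−k}) satisfies 2^k·log 2 − 2 ≤ α₁ < 2^k·log 2. -/
/-- For every integer `k ≥ 1`, the unique positive root
`α₁ = log 2 / (-log (1 - 2^(-k)))` of the first-moment exponent
`φ₁(α) = log 2 + α * log (1 - 2^(-k))` satisfies
`2^k * log 2 - 2 ≤ α₁ < 2^k * log 2`. -/
theorem first_moment_root_bounds (k : ℕ) (hk : 1 ≤ k) :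
    Real.log 2 +
        (Real.log 2 / (-Real.log (1 - (2 : ℝ) ^ (-(k : ℤ))))) *
          Real.log (1 - (2 : ℝ) ^ (-(k : ℤ))) = 0 ∧
    2 ^ k * Real.log 2 - 2 ≤
        Real.log 2 / (-Real.log (1 - (2 : ℝ) ^ (-(k : ℤ)))) ∧
    Real.log 2 / (-Real.log (1 - (2 : ℝ) ^ (-(k : ℤ)))) < 2 ^ k * Real.log 2 := by
  have hN : (2 : ℝ) ≤ 2 ^ k := by
    simpa using pow_le_pow_right₀ (one_le_two : (1 : ℝ) ≤ 2) hk
  rw [zpow_neg, zpow_natCast]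
  generalize (2 : ℝ) ^ k = N at hN ⊢
  have hN0 : 0 < N := by linarith
  have hN1 : 0 < N - 1 := by linarith
  have hinv : 0 < N⁻¹ := inv_pos.mpr hN0
  have hx : 1 - N⁻¹ = (N - 1) / N := by field_simp
  have hpos : 0 < 1 - N⁻¹ := hx ▸ div_pos hN1 hN0
  have hupper : Real.log (1 - N⁻¹) < -N⁻¹ := by
    linarith [Real.log_lt_sub_one_of_pos hpos (by linarith)]
  have hlower : -Real.log (1 - N⁻¹) ≤ (N - 1)⁻¹ := by
    have hle := Real.one_sub_inv_le_log_of_pos hpos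
    have heq : (1 - N⁻¹)⁻¹ - 1 = (N - 1)⁻¹ := by
      rw [hx]
      field_simp
      ring
    linarith
  have hlog : 0 < -Real.log (1 - N⁻¹) := by linarith
  have hlog_two : 0 < Real.log 2 := Real.log_pos one_lt_two
  refine ⟨?_, ?_, ?_⟩
  · rw [div_neg, neg_mul, div_mul_cancel₀ _ (neg_pos.mp hlog).ne]
    ring
  · have hmul : (N - 1) * -Real.log (1 - N⁻¹) ≤ 1 := by
      calc (N - 1) * -Real.log (1 - N⁻¹) ≤ (N - 1) * (N - 1)⁻¹ := by gcongr
        _ = 1 := mul_inv_cancel₀ hN1.ne'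
    have hdiv : (N - 1) * Real.log 2 ≤ Real.log 2 / -Real.log (1 - N⁻¹) := by
      rw [le_div_iff₀ hlog]
      nlinarith
    linarith [Real.log_two_lt_d9]
  · have hmul : 1 < N * -Real.log (1 - N⁻¹) := by
      calc 1 = N * N⁻¹ := (mul_inv_cancel₀ hN0.ne').symm
        _ < N * -Real.log (1 - N⁻¹) := by
          gcongr
          linarith
    rw [div_lt_iff₀ hlog]
    nlinarith
end

section
/- There exist a constant c > 0 and an integer K such that for every integer k ≥ K, every real α with 2^k·log 2 − 2 ≤ α ≤ 2^k·log 2, and every real ε satisfying either −1 ≤ ε ≤ −k·2^{−k/2} or k·2^{−k/2} ≤ ε ≤ 1 − 2k²·2^{−k}, one has φ((1+ε)/2) ≤ −c·k²·2^{−k}. -/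
/-- The binary entropy function `H(z) = -z log z - (1-z) log (1-z)`
(with the convention `0 * log 0 = 0`, automatic since `Real.log 0 = 0`). -/
noncomputable def binH (z : ℝ) : ℝ := -z * Real.log z - (1 - z) * Real.log (1 - z)

/-- The second-moment exponent for satisfying assignments of random `k`-SAT at clause
density `α`, as a function of the overlap `z`. -/
noncomputable def phiSAT (k : ℕ) (α z : ℝ) : ℝ :=
  Real.log 2 + binH z +
    α * Real.log (1 - (2 : ℝ) ^ ((1 : ℤ) - (k : ℤ)) + z ^ k * (2 : ℝ) ^ (-(k : ℤ)))

open Real Filter Topology in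
theorem eventually_large_index_bounds :
    ∀ᶠ k : ℕ in atTop, 8 ≤ (k : ℝ) ∧ (k : ℝ) ^ 2 * (99 / 100 : ℝ) ^ k ≤ 1 / 8 ∧
      5 / 2 ≤ log k ∧ 2 + 2 * log k ≤ log 2 * (k : ℝ) / 2 := by
  have hcast : Tendsto (fun k : ℕ => (k : ℝ)) atTop atTop := tendsto_natCast_atTop_atTop
  have hgeom := tendsto_pow_const_mul_const_pow_of_abs_lt_one 2
    (r := (99 / 100 : ℝ)) (by rw [abs_lt]; constructor <;> norm_num)
  have hlog : ∀ᶠ x : ℝ in atTop, ‖log x‖ ≤ 1 / 10 * ‖x‖ :=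
    isLittleO_log_id_atTop.bound (by norm_num)
  filter_upwards [hcast.eventually_ge_atTop 100, hgeom.eventually_le_const (by norm_num : (0 : ℝ) < 1 / 8),
    (tendsto_log_atTop.comp hcast).eventually_ge_atTop (5 / 2), hcast.eventually hlog]
    with k h₁ h₂ h₃ h₄
  refine ⟨by linarith, h₂, h₃, ?_⟩
  have h₅ := (le_abs_self _).trans h₄
  rw [norm_eq_abs, abs_of_nonneg (by linarith)] at h₅
  nlinarith [log_two_gt_d9]

theorem two_mul_sub_sqrt_le_mul_log {x : ℝ} (hx : 0 ≤ x) :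
    2 * (x - √x) ≤ x * Real.log x := by
  rcases hx.eq_or_lt with rfl | hx
  · simp
  have hs : 0 < √x := Real.sqrt_pos.2 hx
  have hsq : √x ^ 2 = x := Real.sq_sqrt hx.le
  have h := Real.one_sub_inv_le_log_of_pos hs
  rw [Real.log_sqrt hx.le] at h
  have h' := mul_le_mul_of_nonneg_left h hx.le
  have : x * (1 - (√x)⁻¹) = x - √x := by
    field_simp
    linear_combination hsq
  linarith

theorem binH_half_add_le {ε : ℝ} (h₁ : -1 ≤ ε) (h₂ : ε ≤ 1) :
    binH ((1 + ε) / 2) ≤ Real.log 2 - ε ^ 2 / 4 := by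
  have hp : 0 ≤ 1 + ε := by linarith
  have hm : 0 ≤ 1 - ε := by linarith
  have key (x : ℝ) : x / 2 * Real.log (x / 2) = x * Real.log x / 2 - x / 2 * Real.log 2 := by
    rcases eq_or_ne x 0 with rfl | hx
    · simp
    rw [Real.log_div hx two_ne_zero]
    ring
  have hp' := two_mul_sub_sqrt_le_mul_log hp
  have hm' := two_mul_sub_sqrt_le_mul_log hm
  have hsum : √(1 + ε) + √(1 - ε) ≤ 2 - ε ^ 2 / 4 := by
    have a := Real.sq_sqrt hp
    have b := Real.sq_sqrt hm
    have hprod : √(1 + ε) * √(1 - ε) ≤ 1 - ε ^ 2 / 2 := by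
      rw [← Real.sqrt_mul hp]
      apply Real.sqrt_le_iff.2
      constructor <;> nlinarith [sq_nonneg (ε ^ 2)]
    apply abs_le_of_sq_le_sq' _ (by nlinarith) |>.2
    nlinarith [sq_nonneg (ε ^ 2)]
  have e : 1 - (1 + ε) / 2 = (1 - ε) / 2 := by ring
  rw [binH, e, neg_mul, key, key]
  linarith

theorem binH_one_sub_le {δ : ℝ} (h₁ : δ < 1) :
    binH (1 - δ) ≤ -(δ * Real.log δ) + δ := by
  have hpos : 0 < 1 - δ := by linarith
  have h := mul_le_mul_of_nonneg_left (Real.one_sub_inv_le_log_of_pos hpos) hpos.le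
  have : (1 - δ) * (1 - (1 - δ)⁻¹) = -δ := by
    field_simp
    ring
  rw [binH, sub_sub_cancel]
  linarith

theorem one_sub_pow_le_inv_one_add_mul {δ : ℝ} (h₀ : 0 ≤ δ) (h₁ : δ ≤ 1) (k : ℕ) :
    (1 - δ) ^ k ≤ (1 + k * δ)⁻¹ := by
  have hb : 1 + k * δ ≤ (1 + δ) ^ k := one_add_mul_le_pow (by linarith) k
  have hpos : 0 < 1 + k * δ := by positivity
  rw [← one_div, le_div_iff₀ hpos]
  calc (1 - δ) ^ k * (1 + k * δ) ≤ (1 - δ) ^ k * (1 + δ) ^ k := by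
        gcongr
    _ = (1 - δ ^ 2) ^ k := by rw [← mul_pow]; ring
    _ ≤ 1 := pow_le_one₀ (by nlinarith) (by nlinarith)

theorem phiSAT_le {k : ℕ} (hk : 2 ≤ k) {α z : ℝ} (hα : 2 ^ k * Real.log 2 - 2 ≤ α)
    (hα₀ : 0 ≤ α) (h₀ : 0 ≤ z) (h₁ : z ≤ 1) :
    phiSAT k α z ≤ binH z - Real.log 2 * (1 - z ^ k) + 4 * (2 ^ k)⁻¹ := by
  have hP : (4 : ℝ) ≤ 2 ^ k := by
    calc (4 : ℝ) = 2 ^ 2 := by norm_num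
      _ ≤ 2 ^ k := pow_le_pow_right₀ (by norm_num) hk
  have e₁ : (2 : ℝ) ^ ((1 : ℤ) - (k : ℤ)) = 2 * (2 ^ k)⁻¹ := by
    rw [zpow_sub₀ two_ne_zero, zpow_one, zpow_natCast, div_eq_mul_inv]
  have e₂ : (2 : ℝ) ^ (-(k : ℤ)) = (2 ^ k)⁻¹ := by rw [zpow_neg, zpow_natCast]
  rw [phiSAT, e₁, e₂]
  have hq₀ : (0 : ℝ) < (2 ^ k)⁻¹ := by positivity
  have hq : (2 ^ k)⁻¹ * (2 : ℝ) ^ k = 1 := inv_mul_cancel₀ (by positivity)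
  set q : ℝ := (2 ^ k)⁻¹
  have hz₀ : 0 ≤ z ^ k := by positivity
  have hz₁ : z ^ k ≤ 1 := pow_le_one₀ h₀ h₁
  have hpos : 0 < 1 - 2 * q + z ^ k * q := by nlinarith
  have hl := mul_le_mul_of_nonneg_left (Real.log_le_sub_one_of_pos hpos) hα₀
  have hm := mul_le_mul_of_nonneg_right hα (mul_nonneg hq₀.le (by linarith : 0 ≤ 2 - z ^ k))
  have : 2 ^ k * Real.log 2 * (q * (2 - z ^ k)) = Real.log 2 * (2 - z ^ k) := by
    linear_combination Real.log 2 * (2 - z ^ k) * hq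
  nlinarith [mul_nonneg hz₀ hq₀.le]

theorem half_add_pow_le {k : ℕ} {ε : ℝ} (h₀ : -1 ≤ ε) (h₁ : k * ε ≤ 1) :
    ((1 + ε) / 2) ^ k ≤ 3 * (2 ^ k)⁻¹ := by
  rw [div_pow, div_eq_mul_inv]
  gcongr
  calc (1 + ε) ^ k ≤ Real.exp ε ^ k := by
        gcongr
        · linarith
        · linarith [Real.add_one_le_exp ε]
    _ = Real.exp (k * ε) := (Real.exp_nat_mul ε k).symm
    _ ≤ Real.exp 1 := Real.exp_le_exp.2 h₁
    _ ≤ 3 := by linarith [Real.exp_one_lt_d9]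

/-- Far from overlap `1`, the quadratic decay of the entropy dominates `z ^ k`. -/
theorem binH_sub_le_of_le {k : ℕ} {ε : ℝ} (hk : 8 ≤ (k : ℝ))
    (hgeom : (k : ℝ) ^ 2 * (99 / 100 : ℝ) ^ k ≤ 1 / 8) (h₀ : -1 ≤ ε) (h₁ : ε ≤ 49 / 50)
    (hsq : (k : ℝ) ^ 2 * (2 ^ k)⁻¹ ≤ ε ^ 2) :
    binH ((1 + ε) / 2) - Real.log 2 * (1 - ((1 + ε) / 2) ^ k) ≤
      -((k : ℝ) ^ 2 * (2 ^ k)⁻¹) / 8 := by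
  have hH := binH_half_add_le h₀ (by linarith)
  have hl : Real.log 2 < 1 := by linarith [Real.log_two_lt_d9]
  have hz₀ : 0 ≤ ((1 + ε) / 2) ^ k := pow_nonneg (by linarith) k
  have hlz : Real.log 2 * ((1 + ε) / 2) ^ k ≤ ((1 + ε) / 2) ^ k := by nlinarith
  rcases le_total (k * ε) 1 with hε | hε
  · have hz := half_add_pow_le h₀ hε
    have hq₀ : (0 : ℝ) < (2 ^ k)⁻¹ := by positivity
    have hkq : 64 * (2 ^ k)⁻¹ ≤ (k : ℝ) ^ 2 * (2 ^ k)⁻¹ :=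
      mul_le_mul_of_nonneg_right (by nlinarith) hq₀.le
    linarith
  · have hz : ((1 + ε) / 2) ^ k ≤ (99 / 100) ^ k :=
      pow_le_pow_left₀ (by linarith) (by linarith) k
    have hk2 : 0 < (k : ℝ) ^ 2 := by positivity
    have : (99 / 100 : ℝ) ^ k ≤ ε ^ 2 / 8 := by
      apply le_of_mul_le_mul_left _ hk2
      nlinarith
    linarith

/-- Near overlap `1`, `log 2 * (1 - z ^ k)` dominates the entropy. -/
theorem binH_one_sub_sub_le {k : ℕ} {δ : ℝ} (hk : 8 ≤ (k : ℝ)) (hlogk : 5 / 2 ≤ Real.log k)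
    (hlin : 2 + 2 * Real.log k ≤ Real.log 2 * (k : ℝ) / 2)
    (h₀ : (k : ℝ) ^ 2 * (2 ^ k)⁻¹ ≤ δ) (h₁ : δ ≤ 1 / 100) :
    binH (1 - δ) - Real.log 2 * (1 - (1 - δ) ^ k) ≤ -δ := by
  have hk₀ : 0 < (k : ℝ) := by linarith
  have hδ : 0 < δ := lt_of_lt_of_le (by positivity) h₀
  have hl₁ := Real.log_two_lt_d9
  have hl₂ := Real.log_two_gt_d9
  have hH := binH_one_sub_le (δ := δ) (by linarith)
  have hpow := one_sub_pow_le_inv_one_add_mul hδ.le (by linarith) k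
  have hx : 0 < (k : ℝ) * δ := by positivity
  rcases le_total (k ^ 2 * δ) 4 with hs | hs
  · have hi : (1 + k * δ)⁻¹ ≤ 1 - k * δ + (k * δ) ^ 2 := by
      rw [inv_le_iff_one_le_mul₀ (by positivity)]
      nlinarith [pow_pos hx 3]
    have hlog := Real.log_le_log (by positivity) h₀
    rw [Real.log_mul (by positivity) (by positivity), Real.log_pow, Real.log_inv,
      Real.log_pow] at hlog
    push_cast at hlog
    have a := mul_le_mul_of_nonneg_left hlog hδ.le
    have b := mul_le_mul_of_nonneg_left (hpow.trans hi) (by linarith : 0 ≤ Real.log 2)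
    have c := mul_le_mul_of_nonneg_left hs (mul_nonneg hδ.le (by linarith : 0 ≤ Real.log 2))
    have d := mul_le_mul_of_nonneg_left hlogk hδ.le
    have e := mul_le_mul_of_nonneg_left hl₁.le hδ.le
    nlinarith
  rcases le_total (k * δ) 1 with ht | ht
  · have hi : (1 + k * δ)⁻¹ ≤ 1 - k * δ / 2 := by
      rw [inv_le_iff_one_le_mul₀ (by positivity)]
      nlinarith
    have hlog := Real.log_le_log (by norm_num) (by linarith : 1 ≤ (k : ℝ) ^ 2 * δ)
    rw [Real.log_mul (by positivity) (by positivity), Real.log_pow, Real.log_one] at hlog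
    push_cast at hlog
    have a := mul_le_mul_of_nonneg_left hlog hδ.le
    have b := mul_le_mul_of_nonneg_left (hpow.trans hi) (by linarith : 0 ≤ Real.log 2)
    have c := mul_le_mul_of_nonneg_left hlin hδ.le
    nlinarith
  · have hi : (1 + k * δ)⁻¹ ≤ 1 / 2 := by
      rw [inv_le_iff_one_le_mul₀ (by positivity)]
      linarith
    have b := mul_le_mul_of_nonneg_left (hpow.trans hi) (by linarith : 0 ≤ Real.log 2)
    have hsqrt : √δ ≤ 1 / 10 := Real.sqrt_le_iff.2 ⟨by norm_num, by linarith⟩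
    have := two_mul_sub_sqrt_le_mul_log hδ.le
    linarith

/-- There are a constant `c > 0` and an integer `K` such that for every `k ≥ K`, every
`α` with `2^k log 2 - 2 ≤ α ≤ 2^k log 2`, and every `ε` with either
`-1 ≤ ε ≤ -k 2^(-k/2)` or `k 2^(-k/2) ≤ ε ≤ 1 - 2k² 2^(-k)`, one has
`φ((1+ε)/2) ≤ -c k² 2^(-k)`. -/
theorem phi_negative_off_half :
    ∃ c : ℝ, 0 < c ∧ ∃ K : ℕ, ∀ k : ℕ, K ≤ k → ∀ α : ℝ,
      2 ^ k * Real.log 2 - 2 ≤ α → α ≤ 2 ^ k * Real.log 2 → ∀ ε : ℝ,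
      ((-1 ≤ ε ∧ ε ≤ -((k : ℝ) * (2 : ℝ) ^ (-(k : ℝ) / 2))) ∨
        ((k : ℝ) * (2 : ℝ) ^ (-(k : ℝ) / 2) ≤ ε ∧
          ε ≤ 1 - 2 * (k : ℝ) ^ 2 * (2 : ℝ) ^ (-(k : ℤ)))) →
      phiSAT k α ((1 + ε) / 2) ≤ -c * (k : ℝ) ^ 2 * (2 : ℝ) ^ (-(k : ℤ)) := by
  obtain ⟨K, hK⟩ := Filter.eventually_atTop.1 eventually_large_index_bounds
  refine ⟨1 / 16, by norm_num, K, fun k hkK α hα _ ε hε => ?_⟩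
  obtain ⟨hk, hgeom, hlogk, hlin⟩ := hK k hkK
  have hk₂ : 2 ≤ k := by
    have : (2 : ℝ) ≤ k := by linarith
    exact_mod_cast this
  have hα₀ : 0 ≤ α := by
    have : (4 : ℝ) ≤ 2 ^ k := by
      calc (4 : ℝ) = 2 ^ 2 := by norm_num
        _ ≤ 2 ^ k := pow_le_pow_right₀ (by norm_num) hk₂
    nlinarith [Real.log_two_gt_d9]
  have e : (2 : ℝ) ^ (-(k : ℤ)) = (2 ^ k)⁻¹ := by rw [zpow_neg, zpow_natCast]
  have hr : ((2 : ℝ) ^ (-(k : ℝ) / 2)) ^ 2 = (2 ^ k)⁻¹ := by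
    rw [← Real.rpow_natCast, ← Real.rpow_mul (by norm_num), Nat.cast_ofNat,
      div_mul_cancel₀ _ two_ne_zero, Real.rpow_neg (by norm_num), Real.rpow_natCast]
  have hr₀ : 0 ≤ (k : ℝ) * (2 : ℝ) ^ (-(k : ℝ) / 2) := by positivity
  have hq₀ : (0 : ℝ) < (2 ^ k)⁻¹ := by positivity
  rw [e] at hε ⊢
  have hkq : 0 ≤ (k : ℝ) ^ 2 * (2 ^ k)⁻¹ := by positivity
  have hsq : (k : ℝ) ^ 2 * (2 ^ k)⁻¹ ≤ ε ^ 2 := by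
    rw [← hr, ← mul_pow]
    rcases hε with h | h <;> nlinarith
  have hε₀ : -1 ≤ ε := by rcases hε with h | h <;> linarith
  have hε₁ : ε ≤ 1 := by rcases hε with h | h <;> linarith
  have hφ := phiSAT_le hk₂ hα hα₀ (by linarith : 0 ≤ (1 + ε) / 2) (by linarith)
  have hmain : binH ((1 + ε) / 2) - Real.log 2 * (1 - ((1 + ε) / 2) ^ k) ≤
      -((k : ℝ) ^ 2 * (2 ^ k)⁻¹) / 8 := by
    rcases le_total ε (49 / 50) with h | h
    · exact binH_sub_le_of_le hk hgeom hε₀ h hsq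
    · have hδ : (k : ℝ) ^ 2 * (2 ^ k)⁻¹ ≤ (1 - ε) / 2 := by
        rcases hε with h' | h' <;> linarith
      have := binH_one_sub_sub_le hk hlogk hlin hδ (by linarith)
      rw [show 1 - (1 - ε) / 2 = (1 + ε) / 2 by ring] at this
      linarith
  have hkq₆₄ : 64 * (2 ^ k)⁻¹ ≤ (k : ℝ) ^ 2 * (2 ^ k)⁻¹ :=
    mul_le_mul_of_nonneg_right (by nlinarith) hq₀.le
  linarith
end

section
/- Let F(x,y) = (1−x)·e^y / (1 + (1−x)·e^y). If x₁, x₂ ∈ [0,1] and y₁, y₂ ∈ ℝ satisfy x₁·e^{y₁} ≤ 1 and x₂·e^{y₂} ≤ 1, then |F(x₁,y₁) − F(x₂,y₂)| ≤ |x₁ − x₂| + |y₁ − y₂|. -/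
/-- The function `F(x,y) = (1-x) e^y / (1 + (1-x) e^y)`. -/
noncomputable def Ffun (x y : ℝ) : ℝ :=
  (1 - x) * Real.exp y / (1 + (1 - x) * Real.exp y)

theorem one_add_mul_exp_pos {x : ℝ} (hx : x ≤ 1) (y : ℝ) :
    0 < 1 + (1 - x) * Real.exp y := by
  have : 0 ≤ (1 - x) * Real.exp y := mul_nonneg (by linarith) (Real.exp_pos y).le
  linarith

theorem abs_Ffun_sub_right_le_of_le {x y z : ℝ} (hx : x ≤ 1) (hzy : z ≤ y) :
    |Ffun x y - Ffun x z| ≤ y - z := by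
  have hy := one_add_mul_exp_pos hx y
  have hz := one_add_mul_exp_pos hx z
  have hc : 0 ≤ 1 - x := by linarith
  have hexp : Real.exp y - Real.exp z ≤ Real.exp y * (y - z) := by
    have h := Real.add_one_le_exp (z - y)
    have hm : Real.exp z = Real.exp y * Real.exp (z - y) := by
      rw [← Real.exp_add]; ring_nf
    rw [hm]
    nlinarith [Real.exp_pos y]
  have hmono : Real.exp z ≤ Real.exp y := Real.exp_le_exp.mpr hzy
  have hdiff : Ffun x y - Ffun x z = (1 - x) * (Real.exp y - Real.exp z) /
      ((1 + (1 - x) * Real.exp y) * (1 + (1 - x) * Real.exp z)) := by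
    unfold Ffun
    rw [div_sub_div _ _ hy.ne' hz.ne']
    ring
  rw [hdiff, abs_of_nonneg (div_nonneg (mul_nonneg hc (by linarith)) (mul_pos hy hz).le),
    div_le_iff₀ (mul_pos hy hz)]
  have hden : (1 - x) * Real.exp y ≤
      (1 + (1 - x) * Real.exp y) * (1 + (1 - x) * Real.exp z) := by
    nlinarith [mul_nonneg hy.le (mul_nonneg hc (Real.exp_pos z).le)]
  calc (1 - x) * (Real.exp y - Real.exp z)
      ≤ (1 - x) * (Real.exp y * (y - z)) := mul_le_mul_of_nonneg_left hexp hc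
    _ = (y - z) * ((1 - x) * Real.exp y) := by ring
    _ ≤ _ := mul_le_mul_of_nonneg_left hden (by linarith)

/-- `F(x, ·)` is `1`-Lipschitz for `x ≤ 1`. -/
theorem abs_Ffun_sub_right_le {x : ℝ} (hx : x ≤ 1) (y z : ℝ) :
    |Ffun x y - Ffun x z| ≤ |y - z| := by
  rcases le_total z y with h | h
  · exact (abs_Ffun_sub_right_le_of_le hx h).trans (le_abs_self _)
  · rw [abs_sub_comm, abs_sub_comm y z]
    exact (abs_Ffun_sub_right_le_of_le hx h).trans (le_abs_self _)

theorem abs_Ffun_sub_left_le_of_le {w x y : ℝ} (hwx : w ≤ x) (hx : x ≤ 1)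
    (h : x * Real.exp y ≤ 1) : |Ffun w y - Ffun x y| ≤ x - w := by
  have hw' := one_add_mul_exp_pos (hwx.trans hx) y
  have hx' := one_add_mul_exp_pos hx y
  have hdiff : Ffun w y - Ffun x y = (x - w) * Real.exp y /
      ((1 + (1 - w) * Real.exp y) * (1 + (1 - x) * Real.exp y)) := by
    unfold Ffun
    rw [div_sub_div _ _ hw'.ne' hx'.ne']
    ring
  have hw1 : 0 ≤ (1 - w) * Real.exp y := mul_nonneg (by linarith) (Real.exp_pos y).le
  have hden : Real.exp y ≤ (1 + (1 - w) * Real.exp y) * (1 + (1 - x) * Real.exp y) := by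
    nlinarith [mul_nonneg hw1 hx'.le]
  rw [hdiff, abs_of_nonneg (div_nonneg (mul_nonneg (by linarith) (Real.exp_pos y).le)
    (mul_pos hw' hx').le), div_le_iff₀ (mul_pos hw' hx')]
  exact mul_le_mul_of_nonneg_left hden (by linarith)

theorem abs_Ffun_sub_le_of_le {x₁ x₂ : ℝ} (y₁ y₂ : ℝ) (hx : x₁ ≤ x₂) (hx₂ : x₂ ≤ 1)
    (h₂ : x₂ * Real.exp y₂ ≤ 1) :
    |Ffun x₁ y₁ - Ffun x₂ y₂| ≤ |x₁ - x₂| + |y₁ - y₂| := by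
  have hy := abs_Ffun_sub_right_le (hx.trans hx₂) y₁ y₂
  have hx' := abs_Ffun_sub_left_le_of_le hx hx₂ h₂
  have htri := abs_sub_le (Ffun x₁ y₁) (Ffun x₁ y₂) (Ffun x₂ y₂)
  have habs := neg_le_abs (x₁ - x₂)
  linarith

/-- If `x₁, x₂ ∈ [0,1]` and `y₁, y₂ ∈ ℝ` satisfy `x₁ e^{y₁} ≤ 1` and `x₂ e^{y₂} ≤ 1`,
then `|F(x₁,y₁) - F(x₂,y₂)| ≤ |x₁ - x₂| + |y₁ - y₂|`. -/
theorem Ffun_lipschitz (x₁ x₂ y₁ y₂ : ℝ)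
    (hx₁ : x₁ ∈ Set.Icc (0 : ℝ) 1) (hx₂ : x₂ ∈ Set.Icc (0 : ℝ) 1)
    (h₁ : x₁ * Real.exp y₁ ≤ 1) (h₂ : x₂ * Real.exp y₂ ≤ 1) :
    |Ffun x₁ y₁ - Ffun x₂ y₂| ≤ |x₁ - x₂| + |y₁ - y₂| := by
  rcases le_total x₁ x₂ with h | h
  · exact abs_Ffun_sub_le_of_le y₁ y₂ h hx₂.2 h₂
  · rw [abs_sub_comm, abs_sub_comm x₁, abs_sub_comm y₁]
    exact abs_Ffun_sub_le_of_le y₂ y₁ h hx₁.2 h₁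
end

section
/- Let F(x,y) = (1−x)·e^y / (1 + (1−x)·e^y). For all x₁, x₂ ∈ [0,1) and all y₁, y₂ ∈ ℝ, |F(x₁,y₁) − F(x₂,y₂)| ≤ (F(x₁,y₁) + F(x₂,y₂)) · ( |x₁ − x₂| / ((1−x₁) + (1−x₂)) + |y₁ − y₂| / 2 ). -/
/-- The ratio metric `|u - v| / (u + v)` on pairs of exponentials is dominated by half the distance
of the exponents. -/
lemma abs_exp_sub_exp_div_le (y z : ℝ) :
    |Real.exp y - Real.exp z| / (Real.exp y + Real.exp z) ≤ |y - z| / 2 := by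
  wlog h : z ≤ y generalizing y z
  · rw [abs_sub_comm, add_comm, abs_sub_comm y]
    exact this z y (le_of_not_ge h)
  have hexp : Real.exp z ≤ Real.exp y := Real.exp_le_exp.mpr h
  rw [abs_of_nonneg (sub_nonneg.mpr hexp), abs_of_nonneg (sub_nonneg.mpr h)]
  have hz := Real.exp_pos z
  have hlog := Real.le_log_one_add_of_nonneg
    (x := Real.exp (y - z) - 1) (by linarith [Real.one_le_exp (sub_nonneg.mpr h)])
  rw [add_sub_cancel, Real.log_exp, Real.exp_sub] at hlog
  have heq : 2 * (Real.exp y / Real.exp z - 1) / (Real.exp y / Real.exp z - 1 + 2) =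
      2 * ((Real.exp y - Real.exp z) / (Real.exp y + Real.exp z)) := by
    have hyz : Real.exp y / Real.exp z - 1 + 2 = (Real.exp y + Real.exp z) / Real.exp z := by
      field_simp
      ring
    rw [hyz]
    field_simp
  linarith

/-- The ratio metric `|u - v| / (u + v)` on positive reals is subadditive under products. -/
lemma abs_mul_sub_mul_div_le {a b p q : ℝ} (ha : 0 < a) (hb : 0 < b) (hp : 0 < p) (hq : 0 < q) :
    |a * p - b * q| / (a * p + b * q) ≤ |a - b| / (a + b) + |p - q| / (p + q) := by
  wlog h : b * q ≤ a * p generalizing a b p q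
  · rw [abs_sub_comm, add_comm (a * p), abs_sub_comm a, add_comm a, abs_sub_comm p, add_comm p]
    exact this hb ha hq hp (le_of_not_ge h)
  rw [abs_of_nonneg (sub_nonneg.mpr h)]
  have hap := mul_pos ha hp
  have hbq := mul_pos hb hq
  rcases le_total b a with hab | hab
  · rcases le_total q p with hpq | hpq
    · rw [abs_of_nonneg (sub_nonneg.mpr hab), abs_of_nonneg (sub_nonneg.mpr hpq),
        div_add_div _ _ (by positivity) (by positivity), div_le_div_iff₀ (by positivity)
        (by positivity)]
      nlinarith [mul_nonneg (sub_nonneg.mpr h) (mul_nonneg (sub_nonneg.mpr hab)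
        (sub_nonneg.mpr hpq))]
    · refine le_add_of_le_of_nonneg ?_ (by positivity)
      rw [abs_of_nonneg (sub_nonneg.mpr hab), div_le_div_iff₀ (by positivity) (by positivity)]
      nlinarith [mul_nonneg (mul_pos ha hb).le (sub_nonneg.mpr hpq)]
  · refine le_add_of_nonneg_of_le (by positivity) ?_
    refine le_trans ?_ (div_le_div_of_nonneg_right (le_abs_self _) (by positivity))
    rw [div_le_div_iff₀ (by positivity) (by positivity)]
    nlinarith [mul_nonneg (mul_pos hp hq).le (sub_nonneg.mpr hab)]

/-- The map `u ↦ u / (1 + u)` does not increase the ratio metric `|u - v| / (u + v)`. -/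
lemma abs_div_one_add_sub_le {u v : ℝ} (hu : 0 < u) (hv : 0 < v) :
    |u / (1 + u) - v / (1 + v)| ≤ (u / (1 + u) + v / (1 + v)) * (|u - v| / (u + v)) := by
  have hsub : u / (1 + u) - v / (1 + v) = (u - v) / ((1 + u) * (1 + v)) := by
    field_simp
    ring
  have hadd : (u / (1 + u) + v / (1 + v)) * (|u - v| / (u + v)) =
      |u - v| / ((1 + u) * (1 + v)) * ((u + v + 2 * (u * v)) / (u + v)) := by
    field_simp
    ring
  rw [hsub, hadd, abs_div, abs_of_pos (a := (1 + u) * (1 + v)) (by positivity)]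
  refine le_mul_of_one_le_right (by positivity) ?_
  rw [one_le_div (by positivity)]
  linarith [mul_pos hu hv]


/-- For all `x₁, x₂ ∈ [0,1)` and all `y₁, y₂ ∈ ℝ`,
`|F(x₁,y₁) - F(x₂,y₂)| ≤ (F(x₁,y₁) + F(x₂,y₂)) ·
  (|x₁ - x₂| / ((1-x₁) + (1-x₂)) + |y₁ - y₂| / 2)`. -/
theorem Ffun_ratio_contraction (x₁ x₂ y₁ y₂ : ℝ)
    (hx₁ : x₁ ∈ Set.Ico (0 : ℝ) 1) (hx₂ : x₂ ∈ Set.Ico (0 : ℝ) 1) :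
    |Ffun x₁ y₁ - Ffun x₂ y₂| ≤
      (Ffun x₁ y₁ + Ffun x₂ y₂) *
        (|x₁ - x₂| / ((1 - x₁) + (1 - x₂)) + |y₁ - y₂| / 2) := by
  have ha : 0 < 1 - x₁ := sub_pos.mpr hx₁.2
  have hb : 0 < 1 - x₂ := sub_pos.mpr hx₂.2
  have hp := Real.exp_pos y₁
  have hq := Real.exp_pos y₂
  have hx : |(1 - x₁) - (1 - x₂)| = |x₁ - x₂| := by
    rw [sub_sub_sub_cancel_left, abs_sub_comm]
  unfold Ffun
  refine (abs_div_one_add_sub_le (mul_pos ha hp) (mul_pos hb hq)).trans ?_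
  refine mul_le_mul_of_nonneg_left ?_ (by positivity)
  rw [← hx]
  exact (abs_mul_sub_mul_div_le ha hb hp hq).trans
    (add_le_add_right (abs_exp_sub_exp_div_le y₁ y₂) _)
end

section
/- Let k ≥ 1 be an integer and let a, b : Fin k → ℝ be strictly positive. Then |∏_j a_j − ∏_j b_j| ≤ (∏_j a_j + ∏_j b_j) · Σ_{J} 2^{|J|} · ∏_{j ∈ J} |a_j − b_j| / (a_j + b_j), where the sum ranges over all nonempty subsets J of Fin k. -/
/-- Subadditivity of `|x - y| / (x + y)` under products, with denominators cleared. -/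
theorem abs_mul_sub_mul_mul_le {x y u v : ℝ} (hx : 0 < x) (hy : 0 < y) (hu : 0 < u)
    (hv : 0 < v) :
    |x * u - y * v| * ((x + y) * (u + v)) ≤
      (x * u + y * v) * (|x - y| * (u + v) + |u - v| * (x + y)) := by
  have key : ∀ p q s t : ℝ, |p| ≤ s → |q| ≤ t →
      |p * t + q * s| * (s * t) ≤ (s * t + p * q) * (|p| * t + |q| * s) := by
    intro p q s t hp hq
    have hs : 0 ≤ s := (abs_nonneg p).trans hp
    have ht : 0 ≤ t := (abs_nonneg q).trans hq
    have hpt : |p| * |q| ≤ s * t := by gcongr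
    have hp2 : |p| * |p| ≤ s * s := by gcongr
    have hq2 : |q| * |q| ≤ t * t := by gcongr
    have hP := abs_nonneg p
    have hQ := abs_nonneg q
    rcases le_total 0 (p * q) with h | h
    · have h1 : |p * t + q * s| ≤ |p| * t + |q| * s := by
        refine (abs_add_le _ _).trans_eq ?_
        rw [abs_mul, abs_mul, abs_of_nonneg hs, abs_of_nonneg ht]
      calc |p * t + q * s| * (s * t) ≤ (|p| * t + |q| * s) * (s * t + p * q) := by
            gcongr
            linarith
        _ = _ := mul_comm _ _
    · have hpq : p * q = -(|p| * |q|) := by rw [← abs_mul, abs_of_nonpos h, neg_neg]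
      have h1 : |p * t + q * s| = |(|p| * t - |q| * s)| := by
        rw [← sq_eq_sq₀ (abs_nonneg _) (abs_nonneg _), sq_abs, sq_abs]
        linear_combination (2 * s * t) * hpq - t ^ 2 * sq_abs p - s ^ 2 * sq_abs q
      rw [h1, hpq]
      generalize |p| = P at *
      generalize |q| = Q at *
      have e1 : 0 ≤ Q * (t * (s * s - P * P) + s * (s * t - P * Q)) :=
        mul_nonneg hQ (add_nonneg (mul_nonneg ht (by linarith)) (mul_nonneg hs (by linarith)))
      have e2 : 0 ≤ P * (s * (t * t - Q * Q) + t * (s * t - P * Q)) :=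
        mul_nonneg hP (add_nonneg (mul_nonneg hs (by linarith)) (mul_nonneg ht (by linarith)))
      rcases abs_cases (P * t - Q * s) with ⟨h2, -⟩ | ⟨h2, -⟩ <;> rw [h2] <;> linarith
  have h := key (x - y) (u - v) (x + y) (u + v)
    (abs_le.2 ⟨by linarith, by linarith⟩) (abs_le.2 ⟨by linarith, by linarith⟩)
  have e : (x - y) * (u + v) + (u - v) * (x + y) = 2 * (x * u - y * v) := by ring
  rw [e, abs_mul, abs_two] at h
  linarith

theorem abs_prod_sub_prod_le_mul_sum {ι : Type*} (s : Finset ι) (a b : ι → ℝ)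
    (ha : ∀ j, 0 < a j) (hb : ∀ j, 0 < b j) :
    |∏ j ∈ s, a j - ∏ j ∈ s, b j| ≤
      (∏ j ∈ s, a j + ∏ j ∈ s, b j) * ∑ j ∈ s, |a j - b j| / (a j + b j) := by
  classical
  induction s using Finset.induction_on with
  | empty => simp
  | insert i s hi ih =>
    rw [Finset.prod_insert hi, Finset.prod_insert hi, Finset.sum_insert hi]
    have hA : 0 < ∏ j ∈ s, a j := Finset.prod_pos fun j _ => ha j
    have hB : 0 < ∏ j ∈ s, b j := Finset.prod_pos fun j _ => hb j
    generalize ∏ j ∈ s, a j = A at *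
    generalize ∏ j ∈ s, b j = B at *
    have hi1 := ha i
    have hi2 := hb i
    have h := abs_mul_sub_mul_mul_le hi1 hi2 hA hB
    have hpos : 0 < (a i + b i) * (A + B) := by positivity
    rw [← le_div_iff₀ hpos] at h
    refine h.trans ?_
    rw [mul_div_assoc]
    have hdiv : |A - B| / (A + B) ≤ ∑ j ∈ s, |a j - b j| / (a j + b j) := by
      rw [div_le_iff₀ (by positivity), mul_comm]
      exact ih
    have e : (|a i - b i| * (A + B) + |A - B| * (a i + b i)) / ((a i + b i) * (A + B)) =
        |a i - b i| / (a i + b i) + |A - B| / (A + B) := by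
      field_simp
    rw [e]
    gcongr


/-- For strictly positive `a, b : Fin k → ℝ` (`k ≥ 1`),
`|∏ a - ∏ b| ≤ (∏ a + ∏ b) * Σ_{∅ ≠ J ⊆ Fin k} 2^|J| ∏_{j ∈ J} |a j - b j|/(a j + b j)`. -/
theorem abs_prod_sub_prod_le (k : ℕ) (hk : 1 ≤ k) (a b : Fin k → ℝ)
    (ha : ∀ j, 0 < a j) (hb : ∀ j, 0 < b j) :
    |∏ j, a j - ∏ j, b j| ≤
      (∏ j, a j + ∏ j, b j) *
        ∑ J ∈ (Finset.univ : Finset (Fin k)).powerset.filter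
            (fun J => J.Nonempty),
          (2 : ℝ) ^ J.card * ∏ j ∈ J, |a j - b j| / (a j + b j) := by
  have ht : ∀ j, 0 ≤ |a j - b j| / (a j + b j) := fun j =>
    div_nonneg (abs_nonneg _) (add_pos (ha j) (hb j)).le
  refine (abs_prod_sub_prod_le_mul_sum Finset.univ a b ha hb).trans ?_
  refine mul_le_mul_of_nonneg_left ?_
    (add_nonneg (Finset.prod_nonneg fun j _ => (ha j).le) (Finset.prod_nonneg fun j _ => (hb j).le))
  calc ∑ j, |a j - b j| / (a j + b j)
      ≤ ∑ j, (2 : ℝ) ^ ({j} : Finset (Fin k)).card *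
          ∏ i ∈ {j}, |a i - b i| / (a i + b i) := by
        refine Finset.sum_le_sum fun j _ => ?_
        rw [Finset.card_singleton, Finset.prod_singleton]
        linarith [ht j]
    _ = ∑ J ∈ Finset.univ.image (fun j : Fin k => ({j} : Finset (Fin k))),
          (2 : ℝ) ^ J.card * ∏ i ∈ J, |a i - b i| / (a i + b i) :=
        by rw [Finset.sum_image fun i _ j _ h => Finset.singleton_injective h]
    _ ≤ _ := by
        refine Finset.sum_le_sum_of_subset_of_nonneg ?_ fun J _ _ =>
          mul_nonneg (by positivity) (Finset.prod_nonneg fun j _ => ht j)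
        intro J hJ
        obtain ⟨j, -, rfl⟩ := Finset.mem_image.1 hJ
        simp
end

section
/- Let k ≥ 2 and let T be a finite tree whose vertex set is partitioned into a set V of variables and a set F of clauses, such that every edge of T joins a variable to a clause and every clause has degree at least 2 and at most k. Then for every nonempty subset A ⊆ V, |A| ≥ 1 + (|BSP(A;T)| − 1)/(2(k−1)), and consequently |BSP(A;T)| ≤ 2k·|A|. -/
/-- In a bipartite factor graph `G` on vertex set `W` with variables those `w` with
`isVar w`, two distinct variables are *neighboring* if they are adjacent to a common
clause. -/
def Neighboring {W : Type*} (G : SimpleGraph W) (isVar : W → Prop) (u v : W) : Prop :=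
  u ≠ v ∧ isVar u ∧ isVar v ∧ ∃ c, ¬ isVar c ∧ G.Adj u c ∧ G.Adj v c

/-- The bootstrap percolation `BSP(A; G)` of a set of variables `A`: the smallest set
`S ⊇ A` closed under the rule that any variable having at least two neighboring
variables in `S` belongs to `S`. -/
def BSP {W : Type*} (G : SimpleGraph W) (isVar : W → Prop) (A : Set W) : Set W :=
  ⋂₀ {S : Set W | A ⊆ S ∧
    ∀ v, isVar v → 2 ≤ {u | u ∈ S ∧ Neighboring G isVar v u}.ncard → v ∈ S}

/-- A tree rooted at `r` has a parent function, which fixes the root. -/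
lemma SimpleGraph.IsTree.exists_parent {W : Type*} {G : SimpleGraph W} (hG : G.IsTree) (r : W) :
    ∃ par : W → W, par r = r ∧ ∀ v w, G.Adj v w → par v = w ∨ par w = v := by
  choose p hp using fun v ↦ (hG.existsUnique_path r v).exists
  refine ⟨fun v ↦ (p v).penultimate, ?_, fun v w hvw ↦ ?_⟩
  · have h : p r = .nil := by simpa using hp r
    simp [h]
  · by_cases hw : w ∈ (p v).support
    · exact .inl (hG.isAcyclic.eq_penultimate_of_adj_end (hp v) hvw hw).symm
    · have hv := hG.isAcyclic.mem_support_of_ne_mem_support_of_adj_of_isPath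
        (hp w) (hp v) hvw.symm hw
      exact .inr (hG.isAcyclic.eq_penultimate_of_adj_end (hp w) hvw.symm hv).symm

/-- In a tree, the neighborhoods of the vertices of `C` cannot be packed into too small a
nonempty set `D`. -/
lemma SimpleGraph.IsTree.sum_degree_sub_one_lt_card {W : Type*} [Fintype W] {G : SimpleGraph W}
    [DecidableRel G.Adj] (hG : G.IsTree) {C D : Finset W} (hD : D.Nonempty)
    (hCD : ∀ c ∈ C, G.neighborFinset c ⊆ D) : ∑ c ∈ C, (G.degree c - 1) < D.card := by
  classical
  obtain ⟨r, hr⟩ := hD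
  obtain ⟨par, hroot, hpar⟩ := hG.exists_parent r
  let ch : W → Finset W := fun c ↦ (G.neighborFinset c).filter (par · = c)
  have hch (c : W) : G.degree c - 1 ≤ (ch c).card := by
    have hsub : (G.neighborFinset c).erase (par c) ⊆ ch c := by
      intro v hv
      simp only [Finset.mem_erase, SimpleGraph.mem_neighborFinset] at hv
      simpa [ch, hv.2] using (hpar c v hv.2).resolve_left (Ne.symm hv.1)
    calc G.degree c - 1 = (G.neighborFinset c).card - 1 := by simp
      _ ≤ ((G.neighborFinset c).erase (par c)).card := Finset.pred_card_le_card_erase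
      _ ≤ _ := Finset.card_le_card hsub
  have hdisj : (C : Set W).PairwiseDisjoint ch := by
    intro c _ d _ hcd
    refine Finset.disjoint_left.2 fun v hv hv' ↦ hcd ?_
    exact (Finset.mem_filter.1 hv).2.symm.trans (Finset.mem_filter.1 hv').2
  have hsub : C.biUnion ch ⊆ D.erase r := by
    intro v hv
    obtain ⟨c, hc, hv⟩ := Finset.mem_biUnion.1 hv
    obtain ⟨hvc, rfl⟩ := Finset.mem_filter.1 hv
    refine Finset.mem_erase.2 ⟨?_, hCD _ hc hvc⟩
    rintro rfl
    simp [hroot] at hvc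
  calc ∑ c ∈ C, (G.degree c - 1) ≤ ∑ c ∈ C, (ch c).card := Finset.sum_le_sum fun c _ ↦ hch c
    _ = (C.biUnion ch).card := (Finset.card_biUnion hdisj).symm
    _ ≤ (D.erase r).card := Finset.card_le_card hsub
    _ < D.card := Finset.card_erase_lt_of_mem hr

/-- A set `D ⊇ A`, together with a set `C` of clauses whose neighborhoods lie in `D`, reached from
`A` at a controlled cost. -/
structure IsPercolationState {W : Type*} [Fintype W] (G : SimpleGraph W) [DecidableRel G.Adj]
    (k : ℕ) (A D C : Finset W) : Prop where
  subset : A ⊆ D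
  neighborFinset_subset : ∀ c ∈ C, G.neighborFinset c ⊆ D
  card_le : (D.card : ℤ) + (2 * k - 3) * (D.card - ∑ c ∈ C, ((G.degree c : ℤ) - 1)) ≤
    (2 * k - 2) * A.card

section

variable {W : Type*} [Fintype W] [DecidableEq W] {G : SimpleGraph W} [DecidableRel G.Adj]
  {isVar : W → Prop} {k : ℕ} {A C D : Finset W}

lemma card_union_neighborFinset_add_two_le {c u v : W} {E : Finset W} (huv : u ≠ v)
    (hu : u ∈ E) (hv : v ∈ E) (huc : G.Adj u c) (hvc : G.Adj v c) :
    (E ∪ G.neighborFinset c).card + 2 ≤ E.card + G.degree c := by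
  have hsub : ({u, v} : Finset W) ⊆ E ∩ G.neighborFinset c := by
    simp [Finset.insert_subset_iff, hu, hv, huc.symm, hvc.symm]
  have h := Finset.card_le_card hsub
  rw [Finset.card_pair huv] at h
  have h' := Finset.card_union_add_card_inter E (G.neighborFinset c)
  rw [G.card_neighborFinset_eq_degree] at h'
  lia

/-- Saturating a clause that contains two vertices of `D` and one vertex outside `D`. -/
lemma IsPercolationState.saturate (h : IsPercolationState G k A D C) (hk : 2 ≤ k) {c u u' v : W}
    (hdeg : G.degree c ≤ k) (huu' : u ≠ u') (hu : u ∈ D) (hu' : u' ∈ D) (hv : v ∉ D)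
    (huc : G.Adj u c) (huc' : G.Adj u' c) (hvc : G.Adj v c) :
    IsPercolationState G k A (D ∪ G.neighborFinset c) (insert c C) where
  subset := h.subset.trans Finset.subset_union_left
  neighborFinset_subset d hd := by
    obtain rfl | hd := Finset.mem_insert.1 hd
    · exact Finset.subset_union_right
    · exact (h.neighborFinset_subset d hd).trans Finset.subset_union_left
  card_le := by
    have hcC : c ∉ C := fun hc ↦ hv (h.neighborFinset_subset c hc (by simpa using hvc.symm))
    have hcard := card_union_neighborFinset_add_two_le huu' hu hu' huc huc'
    rw [Finset.sum_insert hcC]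
    have := h.card_le
    zify at hcard hk hdeg
    nlinarith

/-- Infecting a vertex outside `D` with a neighboring vertex in each of two clauses, and saturating
both clauses. -/
lemma IsPercolationState.infect (h : IsPercolationState G k A D C) (hk : 2 ≤ k) {c c' u u' v : W}
    (hdeg : G.degree c ≤ k) (hdeg' : G.degree c' ≤ k) (hcc' : c ≠ c') (hu : u ∈ D) (hu' : u' ∈ D)
    (hv : v ∉ D) (huc : G.Adj u c) (huc' : G.Adj u' c') (hvc : G.Adj v c) (hvc' : G.Adj v c') :
    IsPercolationState G k A (insert v D ∪ G.neighborFinset c ∪ G.neighborFinset c')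
      (insert c' (insert c C)) where
  subset := by
    have := h.subset
    grind
  neighborFinset_subset d hd := by
    have := h.neighborFinset_subset d
    grind
  card_le := by
    have hC (d : W) (hvd : G.Adj v d) : d ∉ C :=
      fun hd ↦ hv (h.neighborFinset_subset d hd (by simpa using hvd.symm))
    have hc' : c' ∉ insert c C := by
      simp [hcc'.symm, hC c' hvc']
    have huv : u ≠ v := fun e ↦ hv (e ▸ hu)
    have huv' : u' ≠ v := fun e ↦ hv (e ▸ hu')
    have h₁ := card_union_neighborFinset_add_two_le (E := insert v D) huv
      (by simp [hu]) (by simp) huc hvc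
    have h₂ := card_union_neighborFinset_add_two_le (E := insert v D ∪ G.neighborFinset c) huv'
      (by simp [hu']) (by simp) huc' hvc'
    rw [Finset.card_insert_of_notMem hv] at h₁
    rw [Finset.sum_insert hc', Finset.sum_insert (hC c hvc)]
    have := h.card_le
    zify at h₁ h₂ hk hdeg hdeg'
    nlinarith

/-- A state that is not closed under percolation can be enlarged. -/
lemma IsPercolationState.exists_card_lt (h : IsPercolationState G k A D C) (hk : 2 ≤ k)
    (hdeg : ∀ c, ¬ isVar c → G.degree c ≤ k) {v : W} (hv : v ∉ D)
    (hvD : 2 ≤ {u | u ∈ (D : Set W) ∧ Neighboring G isVar v u}.ncard) :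
    ∃ D' C', IsPercolationState G k A D' C' ∧ D.card < D'.card := by
  obtain ⟨u, ⟨hu, -, -, -, c, hc, hvc, huc⟩, u', ⟨hu', -, -, -, c', hc', hvc', huc'⟩, huu'⟩ :=
    (Set.one_lt_ncard (Set.toFinite _)).1 hvD
  obtain rfl | hcc' := eq_or_ne c c'
  · exact ⟨_, _, h.saturate hk (hdeg c hc) huu' hu hu' hv huc huc' hvc,
      Finset.card_lt_card ⟨by grind, fun hsub ↦ hv (hsub (by simp [hvc.symm]))⟩⟩
  · exact ⟨_, _, h.infect hk (hdeg c hc) (hdeg c' hc') hcc' hu hu' hv huc huc' hvc hvc',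
      Finset.card_lt_card ⟨by grind, fun hsub ↦ hv (hsub (by simp))⟩⟩

/-- Some state contains the bootstrap percolation of `A`. -/
lemma exists_isPercolationState_BSP_subset (hk : 2 ≤ k) (hdeg : ∀ c, ¬ isVar c → G.degree c ≤ k) :
    ∃ D C, IsPercolationState G k A D C ∧ BSP G isVar A ⊆ D := by
  have hne : ({D | ∃ C, IsPercolationState G k A D C} : Set (Finset W)).Nonempty :=
    ⟨A, ∅, subset_rfl, by simp, by simp; linarith⟩
  obtain ⟨D, ⟨C, h⟩, hmax⟩ := Set.exists_max_image _ Finset.card (Set.toFinite _) hne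
  refine ⟨D, C, h, Set.sInter_subset_of_mem ⟨by simpa using h.subset, fun v _ hvD ↦ ?_⟩⟩
  by_contra hv
  obtain ⟨D', C', h', hlt⟩ := h.exists_card_lt hk hdeg hv hvD
  exact (hmax D' ⟨C', h'⟩).not_gt hlt

end

/-- Let `k ≥ 2` and let `G` be a finite tree whose vertices are partitioned into
variables and clauses such that every edge joins a variable to a clause, and every
clause has degree at least `2` and at most `k`.  Then for every nonempty set `A` of
variables, `|A| ≥ 1 + (|BSP(A;G)| - 1)/(2(k-1))`, and consequently
`|BSP(A;G)| ≤ 2 k |A|`. -/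
theorem bsp_card_bound {W : Type*} [Fintype W] (G : SimpleGraph W)
    [DecidableRel G.Adj] (isVar : W → Prop) (k : ℕ) (hk : 2 ≤ k)
    (htree : G.IsTree)
    (hbip : ∀ u v, G.Adj u v → (isVar u ↔ ¬ isVar v))
    (hdeg : ∀ c, ¬ isVar c → 2 ≤ G.degree c ∧ G.degree c ≤ k)
    (A : Set W) (hA : A.Nonempty) (hAvar : ∀ v ∈ A, isVar v) :
    (1 : ℝ) + (((BSP G isVar A).ncard : ℝ) - 1) / (2 * ((k : ℝ) - 1)) ≤ A.ncard ∧
    ((BSP G isVar A).ncard : ℝ) ≤ 2 * k * A.ncard := by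
  classical
  have hdeg_le (c : W) (hc : ¬ isVar c) : G.degree c ≤ k := (hdeg c hc).2
  lift A to Finset W using A.toFinite
  obtain ⟨D, C, h, hsub⟩ := exists_isPercolationState_BSP_subset (A := A) hk hdeg_le
  have hD : D.Nonempty := (Finset.coe_nonempty.1 hA).mono h.subset
  have hlt := htree.sum_degree_sub_one_lt_card hD h.neighborFinset_subset
  have hcard : (BSP G isVar A).ncard ≤ D.card := by
    simpa using Set.ncard_le_ncard hsub D.finite_toSet
  have hsum : ∑ c ∈ C, ((G.degree c : ℤ) - 1) ≤ ((∑ c ∈ C, (G.degree c - 1) : ℕ) : ℤ) := by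
    push_cast
    exact Finset.sum_le_sum fun c _ ↦ by lia
  have hmain : ((BSP G isVar A).ncard : ℤ) + (2 * k - 3) ≤ (2 * k - 2) * A.card := by
    have := h.card_le
    zify at hlt hcard hk
    push_cast at hsum
    nlinarith
  have hmain' : ((BSP G isVar A).ncard : ℝ) + (2 * k - 3) ≤ (2 * k - 2) * A.card := by
    exact_mod_cast hmain
  have hk' : (2 : ℝ) ≤ k := by exact_mod_cast hk
  rw [Set.ncard_coe_finset]
  constructor
  · have hpos : (0 : ℝ) < 2 * (k - 1) := by linarith
    rw [← le_sub_iff_add_le', div_le_iff₀ hpos]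
    linarith
  · have : (0 : ℝ) ≤ A.card := by positivity
    linarith
end

section
/- Let λ > 0 and let p_j = e^{−λ}·λ^j/j! be the Poisson(λ) probability mass function. Then for all natural numbers x and y, Σ_{j=0}^{y} p_{x+j} ≥ (Σ_{j=0}^{y} p_j) · (Σ_{i=0}^{∞} p_{x+i}). Equivalently, if X is Poisson(λ) distributed and x is a natural number, the conditional law of X − x given X ≥ x is stochastically dominated by the law of X. -/
/-- If the ratio `b i / a i` on indices `i ≥ n` never exceeds its value on indices `j < n`
(in cross-multiplied form), then the partial sums satisfy the corresponding comparison. -/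
theorem sum_range_mul_tsum_le_of_cross_mul_le {a b : ℕ → ℝ} (ha : Summable a) (hb : Summable b)
    (n : ℕ) (h : ∀ j i, j < n → n ≤ i → a j * b i ≤ b j * a i) :
    (∑ j ∈ Finset.range n, a j) * ∑' i, b i ≤ (∑ j ∈ Finset.range n, b j) * ∑' i, a i := by
  have key : (∑ j ∈ Finset.range n, a j) * ∑' i, b (i + n) ≤
      (∑ j ∈ Finset.range n, b j) * ∑' i, a (i + n) := by
    rw [← tsum_mul_left, ← tsum_mul_left]
    refine Summable.tsum_le_tsum (fun i => ?_) (((summable_nat_add_iff n).2 hb).mul_left _)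
      (((summable_nat_add_iff n).2 ha).mul_left _)
    rw [Finset.sum_mul, Finset.sum_mul]
    exact Finset.sum_le_sum fun j hj => h j _ (Finset.mem_range.1 hj) (Nat.le_add_left n i)
  rw [← hb.sum_add_tsum_nat_add n, ← ha.sum_add_tsum_nat_add n]
  linarith

theorem Nat.factorial_add_mul_factorial_le {i j : ℕ} (x : ℕ) (h : j ≤ i) :
    (x + j).factorial * i.factorial ≤ j.factorial * (x + i).factorial := by
  induction x with
  | zero => simp
  | succ x ih =>
    calc (x + 1 + j).factorial * i.factorial
        = (x + j + 1) * ((x + j).factorial * i.factorial) := by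
          rw [Nat.add_right_comm, Nat.factorial_succ, mul_assoc]
      _ ≤ (x + i + 1) * (j.factorial * (x + i).factorial) := by gcongr
      _ = j.factorial * (x + 1 + i).factorial := by
          rw [Nat.add_right_comm x 1 i, Nat.factorial_succ, mul_left_comm]

theorem hasSum_exp_neg_mul_pow_div_factorial (r : ℝ) :
    HasSum (fun j : ℕ => Real.exp (-r) * r ^ j / (j.factorial : ℝ)) 1 := by
  have h := (NormedSpace.expSeries_div_hasSum_exp r).mul_left (Real.exp (-r))
  rw [← Real.exp_eq_exp_ℝ, ← Real.exp_add, neg_add_cancel, Real.exp_zero] at h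
  simpa only [mul_div_assoc] using h


/-- Let `p j = e^(-λ) λ^j / j!` be the Poisson(λ) probability mass function (`λ > 0`).
Then for all naturals `x` and `y`,
`Σ_{j=0}^{y} p (x+j) ≥ (Σ_{j=0}^{y} p j) * (Σ_{i=0}^{∞} p (x+i))`: the conditional law
of `X - x` given `X ≥ x` stochastically dominates... is dominated by the law of `X`. -/
theorem poisson_shifted_tail_ineq (lam : ℝ) (hlam : 0 < lam) (x y : ℕ) :
    (∑ j ∈ Finset.range (y + 1),
        Real.exp (-lam) * lam ^ j / (j.factorial : ℝ)) *
      (∑' i : ℕ, Real.exp (-lam) * lam ^ (x + i) / ((x + i).factorial : ℝ)) ≤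
    ∑ j ∈ Finset.range (y + 1),
      Real.exp (-lam) * lam ^ (x + j) / ((x + j).factorial : ℝ) := by
  have hp := hasSum_exp_neg_mul_pow_div_factorial lam
  have hb : Summable fun i : ℕ =>
      Real.exp (-lam) * lam ^ (x + i) / ((x + i).factorial : ℝ) := by
    simpa only [add_comm x] using (summable_nat_add_iff x).2 hp.summable
  have hcross (j i : ℕ) (hj : j < y + 1) (hi : y + 1 ≤ i) :
      Real.exp (-lam) * lam ^ j / (j.factorial : ℝ) *
          (Real.exp (-lam) * lam ^ (x + i) / ((x + i).factorial : ℝ)) ≤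
        Real.exp (-lam) * lam ^ (x + j) / ((x + j).factorial : ℝ) *
          (Real.exp (-lam) * lam ^ i / (i.factorial : ℝ)) := by
    have hfac : ((x + j).factorial * i.factorial : ℝ) ≤ j.factorial * (x + i).factorial :=
      mod_cast Nat.factorial_add_mul_factorial_le x (hj.le.trans hi)
    have hnum : Real.exp (-lam) * lam ^ j * (Real.exp (-lam) * lam ^ (x + i)) =
        Real.exp (-lam) * lam ^ (x + j) * (Real.exp (-lam) * lam ^ i) := by ring
    rw [div_mul_div_comm, div_mul_div_comm, hnum]
    gcongr
  simpa only [hp.tsum_eq, mul_one] using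
    sum_range_mul_tsum_le_of_cross_mul_le hp.summable hb (y + 1) hcross
end

section
/- For every real α ≥ 4 and all integers k ≥ 2 and ℓ ≥ 1, setting t = (α·k²)^{−ℓ}, one has t + α·k·(exp((k−1)·t) − 1) ≤ (α·k²)^{−(ℓ−1)}. -/
/-- The inductive step for a real `k ≥ 2` and any `t ≥ 0` with `α k² t ≤ 1`. -/
lemma add_mul_exp_sub_one_le {α k t : ℝ} (hα : 4 ≤ α) (hk : 2 ≤ k) (ht : 0 ≤ t)
    (h : α * k ^ 2 * t ≤ 1) :
    t + α * k * (Real.exp ((k - 1) * t) - 1) ≤ α * k ^ 2 * t := by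
  have hx0 : 0 ≤ (k - 1) * t := mul_nonneg (by linarith) ht
  have hx1 : (k - 1) * t ≤ 1 := by
    refine le_trans (mul_le_mul_of_nonneg_right ?_ ht) h
    nlinarith [sq_nonneg k]
  have hexp : Real.exp ((k - 1) * t) - 1 ≤ (k - 1) * t + ((k - 1) * t) ^ 2 := by
    have := (abs_le.mp (Real.abs_exp_sub_one_sub_id_le
      (abs_le.mpr ⟨by linarith, hx1⟩))).2
    linarith
  have hsq : α * k * (k - 1) ^ 2 * t ≤ k := by
    calc α * k * (k - 1) ^ 2 * t ≤ α * k * k ^ 2 * t := by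
          gcongr <;> linarith
      _ = k * (α * k ^ 2 * t) := by ring
      _ ≤ k * 1 := by gcongr
      _ = k := mul_one k
  have hαk : 1 + k ≤ α * k := by nlinarith
  calc t + α * k * (Real.exp ((k - 1) * t) - 1)
      ≤ t + α * k * ((k - 1) * t + ((k - 1) * t) ^ 2) := by gcongr
    _ = t * (1 + α * k * (k - 1) ^ 2 * t + α * k * (k - 1)) := by ring
    _ ≤ t * (α * k + α * k * (k - 1)) := by gcongr; linarith
    _ = α * k ^ 2 * t := by ring

/-- For every real `α ≥ 4` and integers `k ≥ 2`, `ℓ ≥ 1`, setting `t = (α k²)^(-ℓ)`,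
one has `t + α k (exp ((k-1) t) - 1) ≤ (α k²)^(-(ℓ-1))`. -/
theorem pgw_mgf_inductive_step (α : ℝ) (hα : 4 ≤ α) (k ℓ : ℕ) (hk : 2 ≤ k)
    (hℓ : 1 ≤ ℓ) :
    (α * (k : ℝ) ^ 2) ^ (-(ℓ : ℤ)) +
        α * (k : ℝ) *
          (Real.exp (((k : ℝ) - 1) * (α * (k : ℝ) ^ 2) ^ (-(ℓ : ℤ))) - 1) ≤
      (α * (k : ℝ) ^ 2) ^ (1 - (ℓ : ℤ)) := by
  have hk' : (2 : ℝ) ≤ k := by exact_mod_cast hk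
  have hc : 1 ≤ α * (k : ℝ) ^ 2 := by nlinarith
  have hc0 : 0 < α * (k : ℝ) ^ 2 := by linarith
  have hpow : (α * (k : ℝ) ^ 2) ^ (1 - (ℓ : ℤ)) =
      α * (k : ℝ) ^ 2 * (α * (k : ℝ) ^ 2) ^ (-(ℓ : ℤ)) := by
    rw [sub_eq_add_neg, zpow_add₀ hc0.ne', zpow_one]
  rw [hpow]
  refine add_mul_exp_sub_one_le hα hk' (zpow_pos hc0 _).le ?_
  rw [← hpow]
  exact zpow_le_one_of_nonpos₀ hc (by omega)
end

section
/- For every integer k ≥ 2 and every real β ≥ k, e^{−β}·(e^β/(2·cosh β))^{k−1} + 1 − (e^β/(2·cosh β))^{k−1} ≤ e^{−β/2}. -/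
theorem Real.exp_div_two_mul_cosh_eq (β : ℝ) :
    Real.exp β / (2 * Real.cosh β) = 1 / (1 + Real.exp (-β / 2) ^ 4) := by
  have h4 : Real.exp (-β / 2) ^ 4 = Real.exp (-β) * Real.exp (-β) := by
    rw [← Real.exp_nat_mul, ← Real.exp_add]
    congr 1
    push_cast
    ring
  have h : Real.exp β * Real.exp (-β) = 1 := by rw [← Real.exp_add]; simp
  have hc : 2 * Real.cosh β = Real.exp β + Real.exp (-β) := by rw [Real.cosh_eq]; ring
  rw [h4, hc, div_eq_div_iff (by positivity) (by positivity)]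
  linear_combination Real.exp (-β) * h

theorem one_sub_mul_pow_four_le_one_div_pow (n : ℕ) (y : ℝ) :
    1 - n * y ^ 4 ≤ (1 / (1 + y ^ 4)) ^ n := by
  have hp : 0 ≤ 1 / (1 + y ^ 4) := by positivity
  have hle : 1 - y ^ 4 ≤ 1 / (1 + y ^ 4) := by
    rw [le_div_iff₀ (by positivity)]
    nlinarith [sq_nonneg (y ^ 4)]
  have hb := one_add_mul_sub_le_pow (by linarith : -1 ≤ 1 / (1 + y ^ 4)) n
  have hn : (n : ℝ) * (1 - y ^ 4) ≤ n * (1 / (1 + y ^ 4)) := by gcongr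
  linarith

/-- For every integer `k ≥ 2` and real `β ≥ k`,
`e^(-β) (e^β/(2 cosh β))^(k-1) + 1 - (e^β/(2 cosh β))^(k-1) ≤ e^(-β/2)`. -/
theorem interpolation_weight_bound (k : ℕ) (hk : 2 ≤ k) (β : ℝ) (hβ : (k : ℝ) ≤ β) :
    Real.exp (-β) * (Real.exp β / (2 * Real.cosh β)) ^ (k - 1) + 1 -
        (Real.exp β / (2 * Real.cosh β)) ^ (k - 1) ≤
      Real.exp (-β / 2) := by
  have hk' : (2 : ℝ) ≤ k := by exact_mod_cast hk
  have hsq : Real.exp (-β) = Real.exp (-β / 2) ^ 2 := by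
    rw [← Real.exp_nat_mul]
    congr 1
    push_cast
    ring
  have hinv : Real.exp (-β / 2) * Real.exp (β / 2) = 1 := by
    rw [← Real.exp_add, ← Real.exp_zero]
    congr 1
    ring
  have hexp : Real.exp (-β) * Real.exp β = 1 := by rw [← Real.exp_add]; simp
  have hn : ((k - 1 : ℕ) : ℝ) ≤ Real.exp β := by
    rw [Nat.cast_sub (by omega)]
    push_cast
    linarith [Real.add_one_le_exp β]
  have hz : 2 ≤ Real.exp (β / 2) := by linarith [Real.add_one_le_exp (β / 2)]
  have hpow := one_sub_mul_pow_four_le_one_div_pow (k - 1) (Real.exp (-β / 2))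
  have hny : Real.exp (-β) * ((k - 1 : ℕ) : ℝ) ≤ 1 := by
    rw [← hexp]
    gcongr
  rw [Real.exp_div_two_mul_cosh_eq]
  rw [hsq] at hny ⊢
  have hy := Real.exp_pos (-β / 2)
  generalize Real.exp (-β / 2) = y at *
  generalize (1 / (1 + y ^ 4)) ^ (k - 1) = q at *
  generalize ((k - 1 : ℕ) : ℝ) = n at *
  have hy2 : y ≤ 1 / 2 := by nlinarith
  have hn4 : n * y ^ 4 ≤ y ^ 2 := by nlinarith [sq_nonneg y]
  have hq : 1 - y ^ 2 ≤ q := by linarith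
  have h1 : 0 ≤ 1 - y ^ 2 := by nlinarith
  nlinarith [mul_le_mul_of_nonneg_left hq h1, sq_nonneg (y ^ 2)]
end

section
/- Let m ≥ 2 be an integer and let η, η̃ : Fin m → ℝ with 0 ≤ η_j < 1 and 0 ≤ η̃_j < 1 for all j. For each j set u_j = (∏_{j' < j} η̃_{j'}) · (∏_{j' > j} η_{j'}) (so 0 ≤ u_j < 1). Then |log(1 − ∏_j η_j) − log(1 − ∏_j η̃_j)| ≤ Σ_j (u_j/(1 − u_j)) · |η_j − η̃_j|. -/
theorem Finset.prod_lt_one_of_mem_Ico {ι : Type*} {s : Finset ι} {f : ι → ℝ}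
    (hs : s.Nonempty) (hf : ∀ i ∈ s, 0 ≤ f i ∧ f i < 1) : ∏ i ∈ s, f i < 1 := by
  classical
  obtain ⟨k, hk⟩ := hs
  rw [← Finset.mul_prod_erase s f hk]
  have hle : ∏ i ∈ s.erase k, f i ≤ 1 :=
    Finset.prod_le_one (fun i hi => (hf i (Finset.mem_of_mem_erase hi)).1)
      fun i hi => (hf i (Finset.mem_of_mem_erase hi)).2.le
  exact (mul_le_of_le_one_right (hf k hk).1 hle).trans_lt (hf k hk).2

theorem Real.log_one_sub_mul_sub_le {u a b : ℝ} (hu0 : 0 ≤ u) (hu1 : u < 1)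
    (ha : a ≤ 1) (hb : b ≤ 1) :
    Real.log (1 - u * a) - Real.log (1 - u * b) ≤ u / (1 - u) * |a - b| := by
  have hu : 0 < 1 - u := sub_pos.2 hu1
  have ha' : 1 - u ≤ 1 - u * a := by nlinarith
  have hb' : 1 - u ≤ 1 - u * b := by nlinarith
  have ha0 : 0 < 1 - u * a := hu.trans_le ha'
  have hb0 : 0 < 1 - u * b := hu.trans_le hb'
  rw [← Real.log_div ha0.ne' hb0.ne']
  calc Real.log ((1 - u * a) / (1 - u * b))
      ≤ (1 - u * a) / (1 - u * b) - 1 := Real.log_le_sub_one_of_pos (div_pos ha0 hb0)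
    _ = u * (b - a) / (1 - u * b) := by field_simp; ring
    _ ≤ u * |a - b| / (1 - u * b) := by
        gcongr
        rw [abs_sub_comm]
        exact le_abs_self _
    _ ≤ u * |a - b| / (1 - u) := by gcongr
    _ = u / (1 - u) * |a - b| := by ring

theorem Real.abs_log_one_sub_mul_sub_le {u a b : ℝ} (hu0 : 0 ≤ u) (hu1 : u < 1)
    (ha : a ≤ 1) (hb : b ≤ 1) :
    |Real.log (1 - u * a) - Real.log (1 - u * b)| ≤ u / (1 - u) * |a - b| := by
  refine abs_sub_le_iff.2 ⟨Real.log_one_sub_mul_sub_le hu0 hu1 ha hb, ?_⟩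
  rw [abs_sub_comm]
  exact Real.log_one_sub_mul_sub_le hu0 hu1 hb ha

/-- Let `m ≥ 2` and `η, η̃ : Fin m → ℝ` with all entries in `[0,1)`.  With
`u j = (∏_{j' < j} η̃ j') * (∏_{j' > j} η j')`, one has
`|log (1 - ∏ η) - log (1 - ∏ η̃)| ≤ Σ_j (u j / (1 - u j)) |η j - η̃ j|`. -/
theorem log_one_sub_prod_telescope (m : ℕ) (hm : 2 ≤ m) (η η' : Fin m → ℝ)
    (hη : ∀ j, 0 ≤ η j ∧ η j < 1) (hη' : ∀ j, 0 ≤ η' j ∧ η' j < 1)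
    (u : Fin m → ℝ)
    (hu : ∀ j, u j =
      (∏ j' ∈ Finset.univ.filter (fun j' : Fin m => j' < j), η' j') *
        ∏ j' ∈ Finset.univ.filter (fun j' : Fin m => j < j'), η j') :
    |Real.log (1 - ∏ j, η j) - Real.log (1 - ∏ j, η' j)| ≤
      ∑ j, u j / (1 - u j) * |η j - η' j| := by
  have hu0 (j : Fin m) : 0 ≤ u j := by
    rw [hu]
    exact mul_nonneg (Finset.prod_nonneg fun i _ => (hη' i).1)
      (Finset.prod_nonneg fun i _ => (hη i).1)
  have hu1 (j : Fin m) : u j < 1 := by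
    rw [hu]
    have : Nontrivial (Fin m) := Fin.nontrivial_iff_two_le.2 hm
    obtain ⟨k, hk⟩ := exists_ne j
    rcases hk.lt_or_gt with h | h
    · refine (mul_le_of_le_one_right (Finset.prod_nonneg fun i _ => (hη' i).1)
        (Finset.prod_le_one (fun i _ => (hη i).1) fun i _ => (hη i).2.le)).trans_lt ?_
      exact Finset.prod_lt_one_of_mem_Ico ⟨k, by simpa using h⟩ fun i _ => hη' i
    · refine (mul_le_of_le_one_left (Finset.prod_nonneg fun i _ => (hη i).1)
        (Finset.prod_le_one (fun i _ => (hη' i).1) fun i _ => (hη' i).2.le)).trans_lt ?_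
      exact Finset.prod_lt_one_of_mem_Ico ⟨k, by simpa using h⟩ fun i _ => hη i
  let P : ℕ → ℝ := fun k =>
    (∏ i ∈ Finset.univ.filter (fun i : Fin m => (i : ℕ) < k), η' i) *
      ∏ i ∈ Finset.univ.filter (fun i : Fin m => k ≤ (i : ℕ)), η i
  have hP0 : P 0 = ∏ j, η j := by simp [P]
  have hPm : P m = ∏ j, η' j := by
    have h : Finset.univ.filter (fun i : Fin m => m ≤ (i : ℕ)) = ∅ := by
      ext i; simp
    simp [P, h]
  have hP (j : Fin m) : P j = u j * η j := by
    have h : Finset.univ.filter (fun i : Fin m => (j : ℕ) ≤ i) =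
        insert j (Finset.univ.filter fun i => j < i) := by
      ext i; simp; grind
    simp only [P, h, hu]
    rw [Finset.prod_insert (by simp)]
    simp only [Fin.lt_def]
    ring
  have hP' (j : Fin m) : P (j + 1) = u j * η' j := by
    have h : Finset.univ.filter (fun i : Fin m => (i : ℕ) < j + 1) =
        insert j (Finset.univ.filter fun i => i < j) := by
      ext i; simp; grind
    simp only [P, h, hu]
    rw [Finset.prod_insert (by simp)]
    simp only [Fin.lt_def, Nat.succ_le_iff]
    ring
  have hsum : Real.log (1 - ∏ j, η j) - Real.log (1 - ∏ j, η' j) =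
      ∑ j, (Real.log (1 - u j * η j) - Real.log (1 - u j * η' j)) := by
    simp only [← hP, ← hP', ← hP0, ← hPm]
    rw [Fin.sum_univ_eq_sum_range (fun k => Real.log (1 - P k) - Real.log (1 - P (k + 1))) m,
      Finset.sum_range_sub' fun k => Real.log (1 - P k)]
  rw [hsum]
  exact (Finset.abs_sum_le_sum_abs _ _).trans <| Finset.sum_le_sum fun j _ =>
    Real.abs_log_one_sub_mul_sub_le (hu0 j) (hu1 j) (hη j).2.le (hη' j).2.le
end
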